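/- arXiv:1704.01649 — 11 statements merged into one kernel-verified Lean document; each statement's English description precedes it below -/
import Mathlib

section
/- For a palindromic Ising model, a main-effect logit regression of a response A_i (i.e. logit P(A_i = 1 | regressors) is linear in the regressors with constant coefficients 2λ_{ij}) is equivalent to a main-effect linear regression of A_i (i.e. E(A_i | regressors) is an affine function of the regressors with constant coefficients) if and only if A_i has at most two regressors; with three or more regressors carrying nonzero interactions, a 4-factor linear interaction is introduced in the joint distribution which implies a 3-factor linear interaction in the conditional distribution of the response, destroying the equivalence. -/
open scoped BigOperators Classical

noncomputable section

/-- The value ±1 encoded by a Boolean level. -/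
def sgn (b : Bool) : ℝ := if b then 1 else -1

/-- The quadratic exponent `∑_{s<t} λ_{st} ω_s ω_t` of an Ising model. -/
def isingExp {d : ℕ} (lam : Fin d → Fin d → ℝ) (ω : Fin d → Bool) : ℝ :=
  ∑ s : Fin d, ∑ t : Fin d, if s < t then lam s t * sgn (ω s) * sgn (ω t) else 0

/-- A palindromic Ising model: `P ω = exp(λ_∅ + ∑_{s<t} λ_{st} ω_s ω_t)`, normalized. -/
def IsPalindromicIsing {d : ℕ} (P : (Fin d → Bool) → ℝ) (lam0 : ℝ)
    (lam : Fin d → Fin d → ℝ) : Prop :=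
  (∀ ω, P ω = Real.exp (lam0 + isingExp lam ω)) ∧ (∑ ω : Fin d → Bool, P ω) = 1

/-- Marginal correlation `ρ_{ij} = E[A_i A_j]`. -/
def corr {d : ℕ} (P : (Fin d → Bool) → ℝ) (i j : Fin d) : ℝ :=
  ∑ ω : Fin d → Bool, P ω * sgn (ω i) * sgn (ω j)

/-- The matrix of marginal correlations. -/
def corrMat {d : ℕ} (P : (Fin d → Bool) → ℝ) : Matrix (Fin d) (Fin d) ℝ :=
  Matrix.of fun i j => corr P i j

/-- The probability of the event that the variables in `s` take the levels given by `e`. -/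
def margP {d : ℕ} (P : (Fin d → Bool) → ℝ) (s : Finset (Fin d)) (e : Fin d → Bool) : ℝ :=
  ∑ ω : Fin d → Bool, if (∀ k ∈ s, ω k = e k) then P ω else 0

/-- Conditional expectation `E[A_i | A_s = e_s]`. -/
def condMean {d : ℕ} (P : (Fin d → Bool) → ℝ) (i : Fin d) (s : Finset (Fin d))
    (e : Fin d → Bool) : ℝ :=
  (∑ ω : Fin d → Bool, if (∀ k ∈ s, ω k = e k) then P ω * sgn (ω i) else 0) / margP P s e

/-- Conditional expectation of the product, `E[A_i A_j | A_s = e_s]`. -/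
def condMean2 {d : ℕ} (P : (Fin d → Bool) → ℝ) (i j : Fin d) (s : Finset (Fin d))
    (e : Fin d → Bool) : ℝ :=
  (∑ ω : Fin d → Bool, if (∀ k ∈ s, ω k = e k) then P ω * sgn (ω i) * sgn (ω j) else 0) /
    margP P s e

/-- The conditional (Pearson) correlation `ρ_{ij|e}` of `A_i, A_j` given `A_s = e_s`. -/
def condCorr {d : ℕ} (P : (Fin d → Bool) → ℝ) (i j : Fin d) (s : Finset (Fin d))
    (e : Fin d → Bool) : ℝ :=
  (condMean2 P i j s e - condMean P i s e * condMean P j s e) /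
    Real.sqrt ((1 - (condMean P i s e) ^ 2) * (1 - (condMean P j s e) ^ 2))

/-- The partial correlation `ρ_{ij.c}` computed, as in the Gaussian case, from the
inverse of the submatrix of `Sig` on `{i,j} ∪ c`. -/
def partialCorr {d : ℕ} (Sig : Matrix (Fin d) (Fin d) ℝ) (i j : Fin d)
    (c : Finset (Fin d)) : ℝ :=
  let K := (Matrix.of fun a b : {x // x ∈ insert i (insert j c)} => Sig a.1 b.1)⁻¹
  let iS : {x // x ∈ insert i (insert j c)} := ⟨i, Finset.mem_insert_self i _⟩
  let jS : {x // x ∈ insert i (insert j c)} :=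
    ⟨j, Finset.mem_insert_of_mem (Finset.mem_insert_self j c)⟩
  let num := -(K iS jS)
  num / Real.sqrt (K iS iS * K jS jS)

/-- Conditional independence `a ⫫ b | c` expressed through the factorization of margins. -/
def CondIndep {d : ℕ} (P : (Fin d → Bool) → ℝ) (a b c : Finset (Fin d)) : Prop :=
  ∀ e : Fin d → Bool,
    margP P (a ∪ b ∪ c) e * margP P c e = margP P (a ∪ c) e * margP P (b ∪ c) e

/-- The symmetrized interaction parameter. -/
def lamSym {d : ℕ} (lam : Fin d → Fin d → ℝ) (i j : Fin d) : ℝ :=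
  if i < j then lam i j else lam j i

/-- The concentration graph of an Ising model: an `ij`-edge iff `λ_{ij} ≠ 0`. -/
def concGraph {d : ℕ} (lam : Fin d → Fin d → ℝ) : SimpleGraph (Fin d) :=
  SimpleGraph.fromRel fun s t => lam s t ≠ 0

end

noncomputable section

open Finset

theorem aux_tanh_sub (u B : ℝ) : Real.tanh (u + B) - Real.tanh (u - B) =
    2 * Real.sinh B * Real.cosh B / (Real.cosh u ^ 2 + Real.sinh B ^ 2) := by
  have h1 := (Real.cosh_pos (u + B)).ne'
  have h2 := (Real.cosh_pos (u - B)).ne'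
  have h3 : Real.cosh u ^ 2 + Real.sinh B ^ 2 ≠ 0 := by
    have := Real.cosh_pos u
    positivity
  rw [Real.tanh_eq_sinh_div_cosh, Real.tanh_eq_sinh_div_cosh, div_sub_div _ _ h1 h2,
    div_eq_div_iff (mul_ne_zero h1 h2) h3, Real.sinh_add, Real.sinh_sub, Real.cosh_add,
    Real.cosh_sub]
  have e1 := Real.cosh_sq u
  have e2 := Real.cosh_sq B
  have : (Real.cosh u * Real.cosh B + Real.sinh u * Real.sinh B) *
      (Real.cosh u * Real.cosh B - Real.sinh u * Real.sinh B) =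
      Real.cosh u ^ 2 + Real.sinh B ^ 2 := by
    have : Real.sinh u ^ 2 = Real.cosh u ^ 2 - 1 := by linarith
    linear_combination Real.cosh u ^ 2 * e2 - Real.sinh B ^ 2 * this
  rw [this]
  linear_combination (Real.cosh u ^ 2 + Real.sinh B ^ 2) *
    (2 * Real.sinh B * Real.cosh B) * e1

theorem aux_zero (h A B : ℝ) (hA : A ≠ 0) (hB : B ≠ 0)
    (H : Real.tanh (h + A + B) - Real.tanh (h + A - B) =
      Real.tanh (h - A + B) - Real.tanh (h - A - B)) : h = 0 := by
  rw [aux_tanh_sub, aux_tanh_sub] at H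
  have p1 := Real.cosh_pos (h + A)
  have p2 := Real.cosh_pos (h - A)
  have hs : Real.sinh B ≠ 0 := by simpa using hB
  have hc := (Real.cosh_pos B).ne'
  rw [div_eq_div_iff (by positivity) (by positivity)] at H
  have H2 := mul_left_cancel₀ (mul_ne_zero (mul_ne_zero two_ne_zero hs) hc) H
  rw [Real.cosh_add, Real.cosh_sub] at H2
  have H3 : Real.cosh h * Real.cosh A * Real.sinh A * Real.sinh h = 0 := by linarith
  have := (Real.cosh_pos h).ne'
  have := (Real.cosh_pos A).ne'
  have : Real.sinh A ≠ 0 := by simpa using hA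
  have h5 : Real.sinh h = 0 := by
    refine (mul_eq_zero.1 H3).resolve_left ?_
    positivity
  exact Real.sinh_eq_zero.1 h5

theorem aux_diff {d : ℕ} (lam : Fin d → Fin d → ℝ) (i : Fin d) (e : Fin d → Bool) :
    isingExp lam (Function.update e i true) - isingExp lam (Function.update e i false) =
      2 * ∑ j ∈ Finset.univ \ {i}, lamSym lam i j * sgn (e j) := by
  unfold isingExp
  rw [← Finset.sum_sub_distrib]
  simp_rw [← Finset.sum_sub_distrib]
  have key : ∀ s t : Fin d,
      ((if s < t then lam s t * sgn (Function.update e i true s) *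
          sgn (Function.update e i true t) else 0) -
       (if s < t then lam s t * sgn (Function.update e i false s) *
          sgn (Function.update e i false t) else 0)) =
      (if s = i then (if i < t then 2 * lam i t * sgn (e t) else 0) else 0) +
      (if t = i then (if s < i then 2 * lam s i * sgn (e s) else 0) else 0) := by
    intro s t
    by_cases hs : s = i
    · subst hs
      by_cases ht : t = s
      · subst ht; simp
      · by_cases hl : s < t
        · simp [hl, ht, sgn]; split_ifs <;> ring
        · simp [hl, ht]
    · by_cases ht : t = i
      · subst ht
        by_cases hl : s < t
        · simp [hl, hs, sgn]; split_ifs <;> ring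
        · simp [hl, hs]
      · simp [hs, ht]
  simp_rw [key, Finset.sum_add_distrib]
  rw [Finset.sum_comm]
  simp only [Finset.sum_ite_eq', Finset.mem_univ, if_true]
  rw [← Finset.sum_add_distrib, Finset.mul_sum]
  symm
  apply Finset.sum_subset_zero_on_sdiff (Finset.subset_univ _)
  · intro x hx
    have : x = i := by simpa using hx
    subst this; simp
  · intro x hx
    have hx : x ≠ i := by simpa using hx
    unfold lamSym
    rcases lt_or_gt_of_ne hx with h | h
    · simp [h, h.not_gt]; ring
    · simp [h, h.not_gt]; ring

theorem aux_filter_univ {d : ℕ} (Q : (Fin d → Bool) → ℝ) (e : Fin d → Bool) :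
    (∑ ω : Fin d → Bool, if (∀ k ∈ (Finset.univ : Finset (Fin d)), ω k = e k) then Q ω else 0)
      = Q e := by
  have : ∀ ω : Fin d → Bool, (∀ k ∈ (Finset.univ : Finset (Fin d)), ω k = e k) ↔ ω = e := by
    intro ω; simp [funext_iff]
  simp only [this]
  simp

theorem aux_filter {d : ℕ} (Q : (Fin d → Bool) → ℝ) (i : Fin d) (e : Fin d → Bool) :
    (∑ ω : Fin d → Bool, if (∀ k ∈ Finset.univ \ {i}, ω k = e k) then Q ω else 0)
      = Q (Function.update e i true) + Q (Function.update e i false) := by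
  have hne : Function.update e i true ≠ Function.update e i false := by
    intro h
    have := congrFun h i
    simp at this
  rw [← Finset.sum_filter, ← Finset.sum_pair hne]
  congr 1
  ext ω
  simp only [Finset.mem_filter, Finset.mem_univ, true_and, Finset.mem_sdiff,
    Finset.mem_singleton, Finset.mem_insert]
  constructor
  · intro h
    cases hω : ω i
    · right
      rw [Function.eq_update_iff]; exact ⟨hω, h⟩
    · left
      rw [Function.eq_update_iff]; exact ⟨hω, h⟩
  · rintro (h | h) k hk <;> simp [h, hk]

theorem aux_ratio {d : ℕ} {P : (Fin d → Bool) → ℝ} {lam0 : ℝ} {lam : Fin d → Fin d → ℝ}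
    (hP : IsPalindromicIsing P lam0 lam) (i : Fin d) (e : Fin d → Bool) :
    P (Function.update e i true) = P (Function.update e i false) *
      Real.exp (2 * ∑ j ∈ Finset.univ \ {i}, lamSym lam i j * sgn (e j)) := by
  rw [hP.1, hP.1, ← Real.exp_add, ← aux_diff]
  congr 1; ring

theorem aux_condMean {d : ℕ} {P : (Fin d → Bool) → ℝ} {lam0 : ℝ} {lam : Fin d → Fin d → ℝ}
    (hP : IsPalindromicIsing P lam0 lam) (i : Fin d) (e : Fin d → Bool) :
    condMean P i (Finset.univ \ {i}) e =
      Real.tanh (∑ j ∈ Finset.univ \ {i}, lamSym lam i j * sgn (e j)) := by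
  unfold condMean margP
  rw [aux_filter P, aux_filter (fun ω => P ω * sgn (ω i)), aux_ratio hP]
  have hpos : 0 < P (Function.update e i false) := by rw [hP.1]; exact Real.exp_pos _
  generalize P (Function.update e i false) = p at *
  generalize ∑ j ∈ Finset.univ \ {i}, lamSym lam i j * sgn (e j) = S
  have hE := Real.exp_pos S
  rw [Real.tanh_eq, two_mul, Real.exp_add, Real.exp_neg]
  simp only [Function.update_self, sgn]
  rw [div_eq_div_iff (by positivity) (by positivity)]
  simp
  field_simp
  ring

theorem aux_three {d : ℕ} (s : Finset (Fin d)) (f : Fin d → ℝ) (a b c : Fin d)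
    (ha : a ∈ s) (hb : b ∈ s) (hc : c ∈ s) (hab : a ≠ b) (hac : a ≠ c) (hbc : b ≠ c) :
    ∃ R : ℝ, ∀ x y z : Bool,
      ∑ j ∈ s, f j * sgn ((if j = a then x else if j = b then y else if j = c then z else true)) =
        f a * sgn x + f b * sgn y + f c * sgn z + R := by
  refine ⟨∑ j ∈ s \ {a, b, c}, f j, fun x y z => ?_⟩
  have hsub : ({a, b, c} : Finset (Fin d)) ⊆ s := by
    intro j; simp; rintro (rfl | rfl | rfl) <;> assumption
  rw [← Finset.sum_sdiff hsub, add_comm]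
  congr 1
  · rw [Finset.sum_insert (by simp [hab, hac]), Finset.sum_pair hbc]
    simp [hab.symm, hac.symm, hbc.symm]; ring
  · apply Finset.sum_congr rfl
    intro j hj
    simp only [Finset.mem_sdiff, Finset.mem_insert, Finset.mem_singleton, not_or] at hj
    simp [hj.2, sgn]

theorem aux_tanh_two (A B : ℝ) (x y : Bool) : Real.tanh (A * sgn x + B * sgn y) =
    (Real.tanh (A + B) + Real.tanh (A - B)) / 2 * sgn x +
    (Real.tanh (A + B) - Real.tanh (A - B)) / 2 * sgn y := by
  have h1 := Real.tanh_neg (A + B)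
  have h2 := Real.tanh_neg (A - B)
  rw [show -(A + B) = -A + -B by ring] at h1
  rw [show -(A - B) = -A + B by ring] at h2
  cases x <;> cases y <;> simp only [sgn, if_true, mul_one, mul_neg, Bool.false_eq_true,
    if_false, ← sub_eq_add_neg (A)] <;> linarith

/-- **Equivalence of main-effect logit and main-effect linear regressions
(Proposition 3).**  For a palindromic Ising model, the logit of a response `A_i`
given all remaining variables is always main-effect (linear in the regressors with
constant coefficients `2λ_{ij}`); this logit regression is equivalent to a
main-effect linear regression of `A_i` — i.e. `E(A_i | regressors)` is an affine
function of the regressors with constant coefficients — if and only if `A_i` has at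
most two regressors (variables carrying a nonzero interaction with `A_i`). -/
theorem stmt2 {d : ℕ} (P : (Fin d → Bool) → ℝ) (lam0 : ℝ) (lam : Fin d → Fin d → ℝ)
    (hP : IsPalindromicIsing P lam0 lam) (i : Fin d) :
    -- the main-effect logit regression always holds
    (∀ e : Fin d → Bool,
      Real.log (margP P Finset.univ (Function.update e i true) /
          margP P Finset.univ (Function.update e i false)) =
        2 * ∑ j ∈ Finset.univ \ {i}, lamSym lam i j * sgn (e j)) ∧
    -- and it is equivalent to a main-effect linear regression iff ≤ 2 regressors
    ((∃ β0 : ℝ, ∃ β : Fin d → ℝ, ∀ e : Fin d → Bool,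
        condMean P i (Finset.univ \ {i}) e =
          β0 + ∑ j ∈ Finset.univ \ {i}, β j * sgn (e j)) ↔
      (Finset.univ.filter fun j => j ≠ i ∧ lamSym lam i j ≠ 0).card ≤ 2) := by
  refine ⟨fun e => ?_, ?_⟩
  · unfold margP
    rw [aux_filter_univ, aux_filter_univ, aux_ratio hP]
    have hpos : 0 < P (Function.update e i false) := by rw [hP.1]; exact Real.exp_pos _
    rw [mul_div_cancel_left₀ _ hpos.ne', Real.log_exp]
  simp_rw [aux_condMean hP]
  constructor
  · rintro ⟨β0, β, H⟩
    by_contra hcard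
    rw [not_le, Finset.two_lt_card] at hcard
    obtain ⟨a, ha, b, hb, c, hc, hab, hac, hbc⟩ := hcard
    simp only [Finset.mem_filter, Finset.mem_univ, true_and] at ha hb hc
    have ma : ∀ {j : Fin d}, j ≠ i → j ∈ Finset.univ \ {i} := by intro j hj; simpa using hj
    obtain ⟨R, hR⟩ := aux_three (Finset.univ \ {i}) (lamSym lam i) a b c (ma ha.1) (ma hb.1)
      (ma hc.1) hab hac hbc
    obtain ⟨R', hR'⟩ := aux_three (Finset.univ \ {i}) β a b c (ma ha.1) (ma hb.1)
      (ma hc.1) hab hac hbc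
    have K : ∀ x y z : Bool, Real.tanh (lamSym lam i a * sgn x + lamSym lam i b * sgn y +
        lamSym lam i c * sgn z + R) = β0 + (β a * sgn x + β b * sgn y + β c * sgn z + R') := by
      intro x y z
      rw [← hR, ← hR']
      exact H _
    have Z : ∀ z : Bool, lamSym lam i c * sgn z + R = 0 := by
      intro z
      apply aux_zero _ _ _ ha.2 hb.2
      have k1 := K true true z
      have k2 := K true false z
      have k3 := K false true z
      have k4 := K false false z
      simp only [sgn, if_true, Bool.false_eq_true, if_false] at k1 k2 k3 k4
      generalize lamSym lam i a = A at *
      generalize lamSym lam i b = B at *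
      have t1 : ∀ w : ℝ, w + R + A + B = A * 1 + B * 1 + w + R := by intro w; ring
      have t2 : ∀ w : ℝ, w + R + A - B = A * 1 + B * -1 + w + R := by intro w; ring
      have t3 : ∀ w : ℝ, w + R - A + B = A * -1 + B * 1 + w + R := by intro w; ring
      have t4 : ∀ w : ℝ, w + R - A - B = A * -1 + B * -1 + w + R := by intro w; ring
      rw [t1, t2, t3, t4]
      simp only [sgn]
      rw [k1, k2, k3, k4]
      ring
    have z1 := Z true
    have z2 := Z false
    simp [sgn] at z1 z2
    exact hc.2 (by linarith)
  · intro hcard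
    have hS : ∀ e : Fin d → Bool, ∑ j ∈ Finset.univ \ {i}, lamSym lam i j * sgn (e j) =
        ∑ j ∈ Finset.univ.filter (fun j => j ≠ i ∧ lamSym lam i j ≠ 0),
          lamSym lam i j * sgn (e j) := by
      intro e
      symm
      apply Finset.sum_subset
      · intro j hj
        simp at hj ⊢
        exact hj.1
      · intro j hj hj'
        simp at hj hj'
        simp [hj' hj]
    have hT : ∀ j ∈ Finset.univ.filter (fun j => j ≠ i ∧ lamSym lam i j ≠ 0), j ≠ i := by
      intro j hj
      simp at hj
      exact hj.1
    simp_rw [hS]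
    generalize Finset.univ.filter (fun j => j ≠ i ∧ lamSym lam i j ≠ 0) = T at *
    have h3 : T.card = 0 ∨ T.card = 1 ∨ T.card = 2 := by omega
    rcases h3 with h | h | h
    · rw [Finset.card_eq_zero] at h
      subst h
      exact ⟨0, 0, by simp⟩
    · obtain ⟨a, rfl⟩ := Finset.card_eq_one.1 h
      have hai : a ≠ i := hT a (by simp)
      refine ⟨0, fun j => if j = a then Real.tanh (lamSym lam i a) else 0, fun e => ?_⟩
      simp only [ite_mul, zero_mul, Finset.sum_ite_eq', Finset.sum_singleton]
      simp only [Finset.mem_sdiff, Finset.mem_univ, Finset.mem_singleton, hai,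
        not_false_eq_true, and_self, if_true, zero_add]
      have := aux_tanh_two (lamSym lam i a) 0 (e a) true
      simpa using this
    · obtain ⟨a, b, hab, rfl⟩ := Finset.card_eq_two.1 h
      have hai : a ≠ i := hT a (by simp)
      have hbi : b ≠ i := hT b (by simp)
      refine ⟨0, fun j => (if j = a then
        (Real.tanh (lamSym lam i a + lamSym lam i b) +
          Real.tanh (lamSym lam i a - lamSym lam i b)) / 2 else 0) +
        (if j = b then (Real.tanh (lamSym lam i a + lamSym lam i b) -
          Real.tanh (lamSym lam i a - lamSym lam i b)) / 2 else 0), fun e => ?_⟩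
      simp only [add_mul, Finset.sum_add_distrib, ite_mul, zero_mul, Finset.sum_ite_eq']
      rw [Finset.sum_pair hab, aux_tanh_two]
      simp [hai, hbi]

end
end

section
/- In a palindromic Ising model whose edge-minimal concentration graph is a chordless h-cycle, the induced marginal correlation ρ*_{kℓ} for an uncoupled node pair (k,ℓ) results by tracing the two edge-disjoint paths connecting k and ℓ in the cycle: ρ*_{kℓ} = (∏_{e ∈ p₁} τ_e + ∏_{e ∈ p₂} τ_e)/(1 + ∏_{e ∈ cycle} τ_e), where p₁ and p₂ are the two connecting paths, τ_e = tanh(λ_e) is the hypetan interaction attached to each of the h edges present, and the denominator product runs over all h edges of the cycle. -/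
open scoped BigOperators Classical

noncomputable section

open Finset

lemma sgn_sq (b : Bool) : sgn b * sgn b = 1 := by cases b <;> simp [sgn]

lemma cycle_sum (n : ℕ) : ∀ (c d : Fin n → ℝ) (c' d' : ℝ),
    ∑ ω : Fin (n+1) → Bool,
      (∏ m : Fin n, (c m + d m * (sgn (ω m.castSucc) * sgn (ω m.succ)))) *
        (c' + d' * (sgn (ω 0) * sgn (ω (Fin.last n)))) =
    2 ^ (n+1) * ((∏ m, c m) * c' + (∏ m, d m) * d') := by
  induction n with
  | zero =>
    intro c d c' d'
    have : Fin.last 0 = 0 := rfl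
    simp [this, sgn_sq]
    ring
  | succ n ih =>
    intro c d c' d'
    rw [← (Fin.consEquiv (fun _ : Fin (n+2) => Bool)).sum_comp, Fintype.sum_prod_type_right]
    have key := ih (fun m => c m.succ) (fun m => d m.succ) (2 * (c 0 * c')) (2 * (d 0 * d'))
    rw [Fin.prod_univ_succ, Fin.prod_univ_succ (f := d)]
    calc _ = _ := ?_
      _ = _ := key
      _ = _ := by ring
    refine Finset.sum_congr rfl fun ω _ => ?_
    have e : ∀ t : Bool, (∏ m : Fin (n+1), (c m + d m *
        (sgn ((Fin.cons t ω : Fin (n+2) → Bool) m.castSucc) *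
          sgn ((Fin.cons t ω : Fin (n+2) → Bool) m.succ)))) =
        (c 0 + d 0 * (sgn t * sgn (ω 0))) * ∏ m : Fin n, (c m.succ + d m.succ *
          (sgn (ω m.castSucc) * sgn (ω m.succ))) := by
      intro t
      rw [Fin.prod_univ_succ]
      simp [← Fin.succ_castSucc]
    have e2 : ∀ t : Bool, (Fin.cons t ω : Fin (n+2) → Bool) (Fin.last (n+1)) = ω (Fin.last n) := by
      intro t
      rw [← Fin.succ_last, Fin.cons_succ]
    simp only [Fin.consEquiv_apply, e, e2, Fin.cons_zero]
    rw [Fintype.sum_bool]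
    simp only [sgn, if_true, Bool.false_eq_true, if_false]
    ring

lemma exp_edge (x : ℝ) (a b : Bool) :
    Real.exp (x * sgn a * sgn b) = Real.cosh x * (1 + Real.tanh x * (sgn a * sgn b)) := by
  have h : Real.cosh x ≠ 0 := (Real.cosh_pos x).ne'
  rw [Real.tanh_eq_sinh_div_cosh]
  have e1 : Real.cosh x * (1 + Real.sinh x / Real.cosh x * (sgn a * sgn b))
      = Real.cosh x + Real.sinh x * (sgn a * sgn b) := by field_simp
  rw [e1]
  cases a <;> cases b <;> simp [sgn, Real.cosh_eq, Real.sinh_eq] <;> ring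

lemma isingExp_cycle (n : ℕ) (hn : 3 ≤ n) (lam : Fin (n+1) → Fin (n+1) → ℝ)
    (hedge : ∀ s t : Fin (n+1), (s : ℕ) < (t : ℕ) →
      (lam s t ≠ 0 ↔ ((t : ℕ) = (s : ℕ) + 1 ∨ ((s : ℕ) = 0 ∧ (t : ℕ) = n + 1 - 1))))
    (ω : Fin (n+1) → Bool) :
    isingExp lam ω = (∑ m : Fin n, lam m.castSucc m.succ * sgn (ω m.castSucc) * sgn (ω m.succ))
      + lam 0 (Fin.last n) * sgn (ω 0) * sgn (ω (Fin.last n)) := by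
  unfold isingExp
  have e : ∀ s t : Fin (n+1), (if s < t then lam s t * sgn (ω s) * sgn (ω t) else 0) =
      (if (t : ℕ) = s + 1 then lam s t * sgn (ω s) * sgn (ω t) else 0) +
      (if s = 0 then (if t = Fin.last n then lam s t * sgn (ω s) * sgn (ω t) else 0) else 0) := by
    intro s t
    have h1 := hedge s t
    simp only [Fin.ext_iff, Fin.lt_def, Fin.val_zero, Fin.val_last]
    by_cases hst : (s : ℕ) < t
    · by_cases h0 : lam s t = 0
      · simp [h0]
      · have h2 := (h1 hst).1 h0
        rcases h2 with h2 | h2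
        · have : ¬ ((s : ℕ) = 0 ∧ (t : ℕ) = n) := by omega
          rw [← ite_and]
          rw [if_pos hst, if_pos h2, if_neg this, add_zero]
        · have : ¬ ((t : ℕ) = s + 1) := by omega
          rw [if_pos hst, if_neg this, if_pos h2.1, if_pos (by omega), zero_add]
    · rw [← ite_and, if_neg hst, if_neg (by omega), if_neg (by omega), add_zero]
  simp only [e, Finset.sum_add_distrib]
  congr 1
  · rw [Fin.sum_univ_castSucc]
    have z : ∑ t : Fin (n+1), (if (t : ℕ) = (Fin.last n : Fin (n+1)) + 1 then
        lam (Fin.last n) t * sgn (ω (Fin.last n)) * sgn (ω t) else 0) = 0 := by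
      refine Finset.sum_eq_zero fun t _ => if_neg ?_
      have := t.2
      simp only [Fin.val_last]; omega
    rw [z, add_zero]
    refine Finset.sum_congr rfl fun m _ => ?_
    rw [Finset.sum_eq_single m.succ]
    · simp
    · intro t _ ht
      apply if_neg
      intro h
      apply ht
      ext; simpa using h
    · simp
  · rw [Finset.sum_eq_single 0]
    · simp
    · intro s _ hs; simp [hs]
    · simp

lemma prod_sgn (n : ℕ) (ω : Fin (n+1) → Bool) (k : ℕ) (hk : k < n+1) (l : ℕ) (hkl : k ≤ l)
    (hl : l < n+1) :
    ∏ m : Fin n, (if (m : ℕ) ∈ Finset.Ico k l then sgn (ω m.castSucc) * sgn (ω m.succ) else 1)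
      = sgn (ω ⟨k, hk⟩) * sgn (ω ⟨l, hl⟩) := by
  induction l, hkl using Nat.le_induction with
  | base => simp [sgn_sq]
  | succ l hkl ih =>
    have hl' : l < n := by omega
    have := ih (by omega)
    have e : ∀ m : Fin n, (if (m : ℕ) ∈ Finset.Ico k (l+1) then
          sgn (ω m.castSucc) * sgn (ω m.succ) else 1) =
        (if (m : ℕ) ∈ Finset.Ico k l then sgn (ω m.castSucc) * sgn (ω m.succ) else 1) *
        (if m = ⟨l, hl'⟩ then sgn (ω m.castSucc) * sgn (ω m.succ) else 1) := by
      intro m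
      simp only [Finset.mem_Ico, Fin.ext_iff]
      by_cases h1 : (m : ℕ) = l
      · rw [if_pos (by omega), if_neg (by omega), if_pos h1, one_mul]
      · by_cases h2 : k ≤ (m : ℕ) ∧ (m : ℕ) < l
        · rw [if_pos (by omega), if_pos h2, if_neg h1, mul_one]
        · rw [if_neg (by omega), if_neg h2, if_neg h1, mul_one]
    simp only [e]
    rw [Finset.prod_mul_distrib, this, Finset.prod_ite_eq' Finset.univ, if_pos (Finset.mem_univ _)]
    have : sgn (ω ⟨l, by omega⟩) * sgn (ω ⟨l, by omega⟩) = 1 := sgn_sq _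
    simp only [Fin.castSucc_mk, Fin.succ_mk]
    linear_combination sgn (ω ⟨k, hk⟩) * sgn (ω ⟨l+1, hl⟩) * this

/-- **Induced marginal correlations in a chordless h-cycle (Proposition 4).**
In a palindromic Ising model whose concentration graph is the chordless `h`-cycle
(vertices `0, …, h−1` in cycle order, edge `m` joining `m` and `m+1 mod h`), the
induced marginal correlation `ρ*_{kℓ}` of an uncoupled pair `(k, ℓ)` results by
tracing the two edge-disjoint paths connecting `k` and `ℓ` in the cycle:
`ρ*_{kℓ} = (∏_{e ∈ p₁} τ_e + ∏_{e ∈ p₂} τ_e)/(1 + ∏_{e ∈ cycle} τ_e)`,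
with `τ_e = tanh(λ_e)` the hypetan interaction of each edge present. -/
theorem stmt4 {h : ℕ} (hh : 4 ≤ h) (P : (Fin h → Bool) → ℝ) (lam0 : ℝ)
    (lam : Fin h → Fin h → ℝ) (hP : IsPalindromicIsing P lam0 lam)
    -- the concentration graph is exactly the h-cycle 0 − 1 − ⋯ − (h−1) − 0
    (hedge : ∀ s t : Fin h, (s : ℕ) < (t : ℕ) →
      (lam s t ≠ 0 ↔ ((t : ℕ) = (s : ℕ) + 1 ∨ ((s : ℕ) = 0 ∧ (t : ℕ) = h - 1))))
    -- τ m is the hypetan interaction of the edge joining m and m+1 (mod h)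
    (tau : ℕ → ℝ)
    (htau1 : ∀ s t : Fin h, (t : ℕ) = (s : ℕ) + 1 → tau (s : ℕ) = Real.tanh (lam s t))
    (htau2 : ∀ s t : Fin h, (s : ℕ) = 0 → (t : ℕ) = h - 1 →
      tau (h - 1) = Real.tanh (lam s t))
    -- an uncoupled pair (k, ℓ)
    (k l : Fin h) (hkl : (k : ℕ) < (l : ℕ))
    (hnotadj : ¬ ((l : ℕ) = (k : ℕ) + 1 ∨ ((k : ℕ) = 0 ∧ (l : ℕ) = h - 1))) :
    corr P k l =
      ((∏ m ∈ Finset.Ico (k : ℕ) (l : ℕ), tau m) +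
        ∏ m ∈ Finset.range h \ Finset.Ico (k : ℕ) (l : ℕ), tau m) /
      (1 + ∏ m ∈ Finset.range h, tau m) := by
  obtain ⟨n, rfl⟩ : ∃ n, h = n + 1 := ⟨h - 1, by omega⟩
  obtain ⟨hP1, hP2⟩ := hP
  have ht1 : ∀ m : Fin n, Real.tanh (lam m.castSucc m.succ) = tau m := fun m =>
    (htau1 m.castSucc m.succ (by simp)).symm
  have ht2 : Real.tanh (lam 0 (Fin.last n)) = tau n :=
    (htau2 0 (Fin.last n) (by simp) (by simp)).symm
  obtain ⟨C, hC⟩ : ∃ C : ℝ, ∀ ω, P ω = C *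
      ((∏ m : Fin n, (1 + tau m * (sgn (ω m.castSucc) * sgn (ω m.succ)))) *
        (1 + tau n * (sgn (ω 0) * sgn (ω (Fin.last n))))) := by
    refine ⟨Real.exp lam0 * (∏ m : Fin n, Real.cosh (lam m.castSucc m.succ)) *
      Real.cosh (lam 0 (Fin.last n)), fun ω => ?_⟩
    rw [hP1, isingExp_cycle n (by omega) lam hedge, Real.exp_add, Real.exp_add, Real.exp_sum]
    simp only [exp_edge, Finset.prod_mul_distrib, ht1, ht2]
    ring
  have hZ : C * (2 ^ (n+1) * (1 + ∏ m ∈ Finset.range (n+1), tau m)) = 1 := by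
    refine Eq.trans ?_ hP2
    simp only [hC]
    rw [← Finset.mul_sum]
    have := cycle_sum n (fun _ => 1) (fun m => tau m) 1 (tau n)
    rw [this, Finset.prod_range_succ, Finset.prod_range]
    simp
  have hk := k.2
  have hl := l.2
  have hN : corr P k l = C * (2 ^ (n+1) * ((∏ m ∈ Finset.Ico (k : ℕ) (l : ℕ), tau m) +
        ∏ m ∈ Finset.range (n+1) \ Finset.Ico (k : ℕ) (l : ℕ), tau m)) := by
    unfold corr
    have key := cycle_sum n
      (fun m => if (m : ℕ) ∈ Finset.Ico (k : ℕ) (l : ℕ) then tau m else 1)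
      (fun m => if (m : ℕ) ∈ Finset.Ico (k : ℕ) (l : ℕ) then 1 else tau m) 1 (tau n)
    have hn' : n ∉ Finset.Ico (k : ℕ) (l : ℕ) := by simp only [Finset.mem_Ico]; omega
    have p1 : ∏ m ∈ Finset.Ico (k : ℕ) (l : ℕ), tau m =
        ∏ m : Fin n, if (m : ℕ) ∈ Finset.Ico (k : ℕ) (l : ℕ) then tau m else 1 := by
      rw [← Finset.prod_range (fun m => if m ∈ Finset.Ico (k : ℕ) (l : ℕ) then tau m else 1),
        ← Finset.prod_filter]
      refine Finset.prod_congr ?_ fun _ _ => rfl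
      ext m
      simp only [Finset.mem_Ico, Finset.mem_filter, Finset.mem_range]
      omega
    have p2 : ∏ m ∈ Finset.range (n+1) \ Finset.Ico (k : ℕ) (l : ℕ), tau m =
        (∏ m : Fin n, if (m : ℕ) ∈ Finset.Ico (k : ℕ) (l : ℕ) then 1 else tau m) * tau n := by
      rw [← Finset.prod_range (fun m => if m ∈ Finset.Ico (k : ℕ) (l : ℕ) then 1 else tau m)]
      have : tau n = if n ∈ Finset.Ico (k : ℕ) (l : ℕ) then 1 else tau n := by rw [if_neg hn']
      rw [this, ← Finset.prod_range_succ
        (fun m => if m ∈ Finset.Ico (k : ℕ) (l : ℕ) then 1 else tau m)]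
      have e : ∀ m, (if m ∈ Finset.Ico (k : ℕ) (l : ℕ) then 1 else tau m) =
        if m ∉ Finset.Ico (k : ℕ) (l : ℕ) then tau m else 1 := by intro m; split_ifs <;> rfl
      simp only [e]
      rw [← Finset.prod_filter]
      refine Finset.prod_congr ?_ fun _ _ => rfl
      ext m
      simp only [Finset.mem_Ico, Finset.mem_filter, Finset.mem_range, Finset.mem_sdiff]
    rw [p1, p2, ← mul_one (∏ m : Fin n, if (m : ℕ) ∈ Finset.Ico (k : ℕ) (l : ℕ) then tau m else 1),
      ← key, Finset.mul_sum]
    refine Finset.sum_congr rfl fun ω _ => ?_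
    rw [hC]
    have q := prod_sgn n ω k hk l hkl.le hl
    simp only [Fin.eta] at q
    rw [mul_assoc _ (sgn (ω k)), ← q]
    rw [mul_assoc, mul_right_comm, ← Finset.prod_mul_distrib]
    congr 2
    refine Finset.prod_congr rfl fun m _ => ?_
    have s1 := sgn_sq (ω m.castSucc)
    have s2 := sgn_sq (ω m.succ)
    split_ifs
    · linear_combination tau m * s1 * (sgn (ω m.succ) * sgn (ω m.succ)) + tau m * s2
    · ring
  have hne : (1 + ∏ m ∈ Finset.range (n+1), tau m) ≠ 0 := by
    intro h0
    rw [h0] at hZ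
    simp at hZ
  rw [hN, eq_div_iff hne]
  linear_combination ((∏ m ∈ Finset.Ico (k : ℕ) (l : ℕ), tau m) +
        ∏ m ∈ Finset.range (n+1) \ Finset.Ico (k : ℕ) (l : ℕ), tau m) * hZ


end
end

section
/- The joint distribution of a palindromic Ising model whose edge-minimal concentration graph is a thin tree or a bulged tree can be generated with linear regressions by using any proper single-node elimination scheme: ordering the nodes by such a scheme, each node i has at most two neighbours among the not-yet-eliminated nodes, the conditional probability of A_i given those neighbours is P(A_i = ω_i | neighbours) = ½(1 + Σ_{j ∈ nb(i)} β_{i|j·} ω_i ω_j) with constant linear regression coefficients, and the product of these factors over the elimination scheme recovers the joint distribution. -/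
open scoped BigOperators Classical

noncomputable section

variable {V : Type*}

/-- `c` separates the two distinct vertices `x` and `y` (both outside `c`):
every walk from `x` to `y` meets `c`. -/
def SepPair (G : SimpleGraph V) (c : Set V) (x y : V) : Prop :=
  x ∉ c ∧ y ∉ c ∧ x ≠ y ∧ ∀ w : G.Walk x y, ∃ v ∈ c, v ∈ w.support

/-- `c` separates the disjoint nonempty vertex sets `a` and `b`:
every walk between them meets `c`. -/
def SepSets (G : SimpleGraph V) (c a b : Set V) : Prop :=
  Disjoint a c ∧ Disjoint b c ∧ Disjoint a b ∧ a.Nonempty ∧ b.Nonempty ∧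
    ∀ x ∈ a, ∀ y ∈ b, ∀ w : G.Walk x y, ∃ v ∈ c, v ∈ w.support

/-- A cut-set: a smallest complete (clique) separator of some pair of vertices. -/
def IsCutset (G : SimpleGraph V) (c : Set V) : Prop :=
  G.IsClique c ∧ ∃ x y, SepPair G c x y ∧ ∀ c' ⊂ c, ¬ SepPair G c' x y

/-- A prime set: a nonempty vertex set whose induced subgraph has no cut-set. -/
def IsPrimeSet (G : SimpleGraph V) (S : Set V) : Prop :=
  S.Nonempty ∧ ∀ c : Set S, ¬ IsCutset (G.induce S) c

/-- A prime graph of `G`: a maximal prime set. -/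
def IsPrimeGraphOf (G : SimpleGraph V) (S : Set V) : Prop :=
  IsPrimeSet G S ∧ ∀ T, S ⊆ T → IsPrimeSet G T → T = S

/-- The set `S` is a single edge of `G`. -/
def IsEdgeSet (G : SimpleGraph V) (S : Set V) : Prop :=
  ∃ x y, G.Adj x y ∧ S = {x, y}

/-- The set `S` is a triangle of `G`. -/
def IsTriangleSet (G : SimpleGraph V) (S : Set V) : Prop :=
  ∃ x y z, x ≠ y ∧ x ≠ z ∧ y ≠ z ∧ G.Adj x y ∧ G.Adj x z ∧ G.Adj y z ∧ S = {x, y, z}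

/-- The set `S` induces a cycle of `G` (a triangle or a chordless cycle):
connected and every vertex of the induced subgraph has exactly two neighbours. -/
def IsCycleSet (G : SimpleGraph V) (S : Set V) : Prop :=
  3 ≤ S.ncard ∧ (G.induce S).Connected ∧
    ∀ v : S, {w : S | (G.induce S).Adj v w}.ncard = 2

/-- A hollow tree: a connected graph whose prime graphs are exclusively edges or
cycles and whose cut-sets are single nodes or edges. -/
def IsHollowTree (G : SimpleGraph V) : Prop :=
  G.Connected ∧ (∀ S, IsPrimeGraphOf G S → IsEdgeSet G S ∨ IsCycleSet G S) ∧
    ∀ c, IsCutset G c → c.ncard = 1 ∨ IsEdgeSet G c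

/-- A thin (traditional) tree: prime graphs are single edges, cut-sets single nodes. -/
def IsThinTree (G : SimpleGraph V) : Prop :=
  G.Connected ∧ (∀ S, IsPrimeGraphOf G S → IsEdgeSet G S) ∧
    ∀ c, IsCutset G c → c.ncard = 1

/-- A bulged tree: prime graphs are edges or triangles, cut-sets single nodes. -/
def IsBulgedTree (G : SimpleGraph V) : Prop :=
  G.Connected ∧ (∀ S, IsPrimeGraphOf G S → IsEdgeSet G S ∨ IsTriangleSet G S) ∧
    ∀ c, IsCutset G c → c.ncard = 1

/-- The fattened tree of a hollow tree: each chordless cycle is completed by all its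
missing chords. -/
def IsFattenedTreeOf (F G : SimpleGraph V) : Prop :=
  IsHollowTree G ∧
    ∀ x y, F.Adj x y ↔ G.Adj x y ∨
      (x ≠ y ∧ ∃ S, IsPrimeGraphOf G S ∧ IsCycleSet G S ∧ x ∈ S ∧ y ∈ S)

/-- `O` is an outer node set of the prime graph `S` of `G`: a nonempty part of `S`
meeting no other prime graph. -/
def IsOuterSetOf (G : SimpleGraph V) (O S : Set V) : Prop :=
  IsPrimeGraphOf G S ∧ O.Nonempty ∧ O ⊆ S ∧
    ∀ T, IsPrimeGraphOf G T → (O ∩ T).Nonempty → T = S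

/-- `O` is an outer node set of `G`. -/
def IsOuterSet (G : SimpleGraph V) (O : Set V) : Prop :=
  ∃ S, IsOuterSetOf G O S

end

noncomputable section

/-- The nodes eliminated after step `k` in the elimination order `ord`. -/
def laterSet {d : ℕ} (ord : Equiv.Perm (Fin d)) (k : Fin d) : Finset (Fin d) :=
  Finset.univ.filter fun j => k < ord.symm j

/-- The neighbours of the node eliminated at step `k` among the later nodes. -/
def laterNbrs {d : ℕ} (lam : Fin d → Fin d → ℝ) (ord : Equiv.Perm (Fin d))
    (k : Fin d) : Finset (Fin d) :=
  (laterSet ord k).filter fun j => (concGraph lam).Adj (ord k) j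

/-- The conditional probability `P(A_i = ω_i | A_s = ω_s)`. -/
def condP {d : ℕ} (P : (Fin d → Bool) → ℝ) (i : Fin d) (s : Finset (Fin d))
    (ω : Fin d → Bool) : ℝ :=
  margP P (insert i s) ω / margP P s ω

/-- Dependence of a function on the coordinates in `C` only. -/
def DepOn {d : ℕ} (F : (Fin d → Bool) → ℝ) (C : Finset (Fin d)) : Prop :=
  ∀ x y : Fin d → Bool, (∀ i ∈ C, x i = y i) → F x = F y

/-- Functions factorizing over cliques of `G` inside `S`. -/
inductive Fac {d : ℕ} (G : SimpleGraph (Fin d)) (S : Finset (Fin d)) :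
    ((Fin d → Bool) → ℝ) → Prop
  | one : Fac G S (fun _ => 1)
  | mul (F φ : (Fin d → Bool) → ℝ) (C : Finset (Fin d)) (hF : Fac G S F) (hC : C ⊆ S)
      (hcl : G.IsClique (C : Set (Fin d))) (hφ : DepOn φ C) : Fac G S (fun ω => F ω * φ ω)

lemma Fac.depOn {d : ℕ} {G : SimpleGraph (Fin d)} {S : Finset (Fin d)}
    {F : (Fin d → Bool) → ℝ} (h : Fac G S F) : DepOn F S := by
  induction h with
  | one => intro x y _; rfl
  | mul F φ C hF hC hcl hφ ih =>
    intro x y hxy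
    simp only
    rw [ih x y hxy, hφ x y (fun i hi => hxy i (hC hi))]

lemma Fac.split {d : ℕ} {G : SimpleGraph (Fin d)} {S : Finset (Fin d)}
    {F : (Fin d → Bool) → ℝ} (v : Fin d) (N : Finset (Fin d))
    (hN : ∀ j ∈ S, G.Adj v j → j ∈ N)
    (h : Fac G (insert v S) F) :
    ∃ A B : (Fin d → Bool) → ℝ, (∀ ω, F ω = A ω * B ω) ∧ DepOn A (insert v N) ∧ Fac G S B := by
  induction h with
  | one => exact ⟨fun _ => 1, fun _ => 1, by simp, fun _ _ _ => rfl, Fac.one⟩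
  | mul F φ C hF hC hcl hφ ih =>
    obtain ⟨A, B, hAB, hA, hB⟩ := ih
    by_cases hv : v ∈ C
    · refine ⟨fun ω => A ω * φ ω, B, fun ω => by simp only [hAB]; ring, ?_, hB⟩
      intro x y hxy
      simp only
      rw [hA x y hxy, hφ x y]
      intro i hi
      apply hxy
      by_cases hiv : i = v
      · simp [hiv]
      · refine Finset.mem_insert_of_mem (hN i ?_ ?_)
        · exact (Finset.mem_insert.1 (hC hi)).resolve_left hiv
        · exact hcl (by exact_mod_cast hv) (by exact_mod_cast hi) (Ne.symm hiv)
    · refine ⟨A, fun ω => B ω * φ ω, fun ω => by simp only [hAB]; ring, hA, ?_⟩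
      refine Fac.mul B φ C hB ?_ hcl hφ
      intro i hi
      exact (Finset.mem_insert.1 (hC hi)).resolve_left (fun h => hv (h ▸ hi))

lemma Fac.prod {d : ℕ} {G : SimpleGraph (Fin d)} {S : Finset (Fin d)} {ι : Type}
    (s : Finset ι) (f : ι → (Fin d → Bool) → ℝ) (F : (Fin d → Bool) → ℝ) (hF : Fac G S F)
    (h : ∀ i ∈ s, ∃ C : Finset (Fin d), C ⊆ S ∧ G.IsClique (C : Set (Fin d)) ∧ DepOn (f i) C) :
    Fac G S (fun ω => F ω * ∏ i ∈ s, f i ω) := by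
  induction s using Finset.induction_on with
  | empty => simpa using hF
  | insert a s ha ih =>
    obtain ⟨C, h1, h2, h3⟩ := h a (Finset.mem_insert_self _ _)
    have := Fac.mul _ (f a) C (ih (fun i hi => h i (Finset.mem_insert_of_mem hi))) h1 h2 h3
    convert this using 2 with ω
    rw [Finset.prod_insert ha]; ring

lemma margP_dep {d : ℕ} (P : (Fin d → Bool) → ℝ) (T : Finset (Fin d)) : DepOn (margP P T) T := by
  intro x y h
  unfold margP
  refine Finset.sum_congr rfl fun ω _ => ?_
  have : (∀ k ∈ T, ω k = x k) ↔ (∀ k ∈ T, ω k = y k) :=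
    forall₂_congr fun k hk => by rw [h k hk]
  simp only [this]

lemma margP_pos {d : ℕ} (P : (Fin d → Bool) → ℝ) (hpos : ∀ ω, 0 < P ω) (T : Finset (Fin d))
    (e : Fin d → Bool) : 0 < margP P T e := by
  unfold margP
  refine Finset.sum_pos' (fun ω _ => ?_) ⟨e, Finset.mem_univ _, ?_⟩
  · split_ifs
    · exact (hpos ω).le
    · exact le_rfl
  · simp [hpos]

lemma margP_split {d : ℕ} (P : (Fin d → Bool) → ℝ) (T : Finset (Fin d)) (u : Fin d)
    (hu : u ∉ T) (e : Fin d → Bool) :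
    margP P T e = margP P (insert u T) (Function.update e u true)
      + margP P (insert u T) (Function.update e u false) := by
  unfold margP
  rw [← Finset.sum_add_distrib]
  refine Finset.sum_congr rfl fun ω _ => ?_
  have key : ∀ b, (∀ k ∈ insert u T, ω k = Function.update e u b k) ↔
      (ω u = b ∧ ∀ k ∈ T, ω k = e k) := by
    intro b
    rw [Finset.forall_mem_insert]
    simp only [Function.update_self]
    refine and_congr Iff.rfl (forall₂_congr fun k hk => ?_)
    rw [Function.update_of_ne (fun h : k = u => hu (h ▸ hk))]
  simp only [key]
  cases ω u <;> simp

lemma margP_even {d : ℕ} (P : (Fin d → Bool) → ℝ) (hev : ∀ ω, P (fun i => !ω i) = P ω)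
    (T : Finset (Fin d)) (e : Fin d → Bool) : margP P T (fun i => !e i) = margP P T e := by
  unfold margP
  have hinv : Function.Involutive (fun (ω : Fin d → Bool) => fun i => !ω i) := by
    intro ω; simp
  rw [← Equiv.sum_comp hinv.toPerm]
  refine Finset.sum_congr rfl fun ω _ => ?_
  simp [hev]

lemma margP_ratio {d : ℕ} (P : (Fin d → Bool) → ℝ) (v : Fin d) (N : Finset (Fin d))
    (r : (Fin d → Bool) → ℝ) (hr : DepOn r (insert v N)) (D : Finset (Fin d)) :
    ∀ (T : Finset (Fin d)), T = N ∪ D → v ∉ T → 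
    (∀ e, margP P (insert v T) e = r e * margP P T e) → 
    ∀ e, margP P (insert v N) e = r e * margP P N e := by
  induction D using Finset.induction_on with
  | empty => intro T hT _ h; simpa [hT] using h
  | insert u D hu ih =>
    intro T hT hv h
    have hT' : T = insert u (N ∪ D) := by rw [hT]; simp
    by_cases huN : u ∈ N ∪ D
    · exact ih T (by rw [hT', Finset.insert_eq_of_mem huN]) hv h
    · subst hT'
      have hvu : v ≠ u := fun h => hv (by simp [h])
      have hvN : v ∉ N ∪ D := fun h => hv (Finset.mem_insert_of_mem h)
      refine ih (N ∪ D) rfl hvN fun e => ?_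
      have hu2 : u ∉ insert v (N ∪ D) := by
        rw [Finset.mem_insert]; rintro (h | h)
        · exact hvu h.symm
        · exact huN h
      rw [margP_split P _ u hu2, margP_split P _ u huN, Finset.insert_comm, h, h, mul_add]
      have : ∀ b, r (Function.update e u b) = r e := by
        intro b
        apply hr
        intro i hi
        rw [Function.update_of_ne]
        rintro rfl
        rcases Finset.mem_insert.1 hi with h | h
        · exact hvu h.symm
        · exact huN (Finset.mem_union_left _ h)
      rw [this, this]

lemma fac_step {d : ℕ} (P : (Fin d → Bool) → ℝ) (hpos : ∀ ω, 0 < P ω)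
    (G : SimpleGraph (Fin d)) (v : Fin d) (S N : Finset (Fin d)) (hv : v ∉ S) (hNS : N ⊆ S)
    (hN : ∀ j ∈ S, G.Adj v j → j ∈ N) (hcl : G.IsClique (N : Set (Fin d)))
    (h : Fac G (insert v S) (margP P (insert v S))) :
    Fac G S (margP P S) ∧ ∀ ω, margP P (insert v S) ω = condP P v N ω * margP P S ω := by
  obtain ⟨A, B, hAB, hA, hB⟩ := h.split v N hN
  set As : (Fin d → Bool) → ℝ := fun ω =>
    A (Function.update ω v true) + A (Function.update ω v false) with hAs
  have hAsN : DepOn As N := by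
    intro x y hxy
    have : ∀ b, A (Function.update x v b) = A (Function.update y v b) := by
      intro b
      apply hA
      intro i hi
      by_cases hiv : i = v
      · subst hiv; simp
      · rw [Function.update_of_ne hiv, Function.update_of_ne hiv]
        exact hxy i ((Finset.mem_insert.1 hi).resolve_left hiv)
    simp only [hAs, this]
  have hBv : ∀ ω b, B (Function.update ω v b) = B ω := by
    intro ω b
    apply hB.depOn
    intro i hi
    rw [Function.update_of_ne]
    rintro rfl
    exact hv hi
  have hS : ∀ ω, margP P S ω = B ω * As ω := by
    intro ω
    rw [margP_split P S v hv, hAB, hAB, hBv, hBv]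
    simp only [hAs]; ring
  have hAs0 : ∀ ω, As ω ≠ 0 := by
    intro ω h0
    have := margP_pos P hpos S ω
    rw [hS, h0] at this
    simp at this
  have hr : DepOn (fun ω => A ω / As ω) (insert v N) := by
    intro x y hxy
    simp only
    rw [hA x y hxy, hAsN x y (fun i hi => hxy i (Finset.mem_insert_of_mem hi))]
  have hrat : ∀ ω, margP P (insert v S) ω = (A ω / As ω) * margP P S ω := by
    intro ω
    rw [hAB, hS]
    have := hAs0 ω
    field_simp
  refine ⟨?_, fun ω => ?_⟩
  · have := Fac.mul B As N hB hNS hcl hAsN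
    rwa [show margP P S = fun ω => B ω * As ω from funext hS]
  · have := margP_ratio P v N _ hr S S (Finset.union_eq_right.2 hNS).symm hv hrat ω
    unfold condP
    rw [this, mul_div_cancel_right₀ _ (margP_pos P hpos N ω).ne', hrat]

lemma fac_base {d : ℕ} (P : (Fin d → Bool) → ℝ) (lam0 : ℝ) (lam : Fin d → Fin d → ℝ)
    (hP : IsPalindromicIsing P lam0 lam) : Fac (concGraph lam) Finset.univ P := by
  have hc : Fac (concGraph lam) Finset.univ (fun _ => Real.exp lam0) := by
    have := Fac.mul (G := concGraph lam) (S := Finset.univ) _ (fun _ => Real.exp lam0) ∅ Fac.one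
      (by simp) (by simp) (fun _ _ _ => rfl)
    simpa using this
  have := Fac.prod (Finset.univ : Finset (Fin d × Fin d))
    (fun p ω => Real.exp (if p.1 < p.2 then lam p.1 p.2 * sgn (ω p.1) * sgn (ω p.2) else 0)) _ hc ?_
  · convert this using 1
    funext ω
    rw [hP.1, Real.exp_add, ← Real.exp_sum, isingExp, Fintype.sum_prod_type]
  · rintro ⟨s, t⟩ -
    by_cases h : s < t ∧ lam s t ≠ 0
    · refine ⟨{s, t}, by simp, ?_, ?_⟩
      · have : (concGraph lam).Adj s t := by
          rw [concGraph, SimpleGraph.fromRel_adj]; exact ⟨h.1.ne, Or.inl h.2⟩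
        rw [Finset.coe_pair, SimpleGraph.isClique_pair]
        exact fun _ => this
      · intro x y hxy
        simp only
        rw [hxy s (by simp), hxy t (by simp)]
    · refine ⟨∅, by simp, by simp, ?_⟩
      intro x y _
      simp only
      by_cases hst : s < t
      · have : lam s t = 0 := by by_contra h'; exact h ⟨hst, h'⟩
        simp [this]
      · simp [hst]

lemma isPrime_of_clique {V : Type*} (G : SimpleGraph V) (S : Set V) (hne : S.Nonempty)
    (h : G.IsClique S) : IsPrimeSet G S := by
  refine ⟨hne, ?_⟩
  rintro c ⟨-, x, y, ⟨hx, hy, hxy, hw⟩, -⟩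
  have hadj : (G.induce S).Adj x y := by
    simpa using h x.2 y.2 (fun e => hxy (Subtype.ext e))
  obtain ⟨v, hv, hv'⟩ := hw hadj.toWalk
  simp at hv'
  rcases hv' with rfl | rfl
  · exact hx hv
  · exact hy hv

lemma clique_card {d : ℕ} (G : SimpleGraph (Fin d)) (hT : IsThinTree G ∨ IsBulgedTree G)
    (S : Finset (Fin d)) (hne : S.Nonempty) (h : G.IsClique (S : Set (Fin d))) : S.card ≤ 3 := by
  have hp := isPrime_of_clique G S (by simpa using hne) h
  obtain ⟨M, hSM, hM⟩ := (Set.toFinite {T | IsPrimeSet G T}).exists_le_maximal hp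
  have hMp : IsPrimeGraphOf G M :=
    ⟨hM.prop, fun T hT hTp => (hM.eq_of_le hTp hT).symm⟩
  have hM' : IsEdgeSet G M ∨ IsTriangleSet G M := by
    rcases hT with h | h
    · exact Or.inl (h.2.1 M hMp)
    · exact h.2.1 M hMp
  have hle : S.card ≤ M.ncard := by
    rw [← Set.ncard_coe_finset]
    exact Set.ncard_le_ncard hSM (Set.toFinite _)
  rcases hM' with ⟨x, y, -, rfl⟩ | ⟨x, y, z, -, -, -, -, -, -, rfl⟩
  · have := Set.ncard_insert_le x {y}
    rw [Set.ncard_singleton] at this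
    omega
  · have := Set.ncard_insert_le x {y, z}
    have h2 := Set.ncard_insert_le y {z}
    rw [Set.ncard_singleton] at h2
    omega

lemma regress {d : ℕ} (P : (Fin d → Bool) → ℝ) (hpos : ∀ ω, 0 < P ω)
    (hev : ∀ ω, P (fun i => !ω i) = P ω) (i : Fin d) (N : Finset (Fin d)) (hi : i ∉ N)
    (hN : N.card ≤ 2) :
    ∃ b : Fin d → ℝ, ∀ ω, condP P i N ω =
      (1 / 2) * (1 + ∑ j ∈ N, b j * sgn (ω i) * sgn (ω j)) := by
  have hdep : DepOn (condP P i N) (insert i N) := by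
    intro x y h
    unfold condP
    rw [margP_dep P _ x y h, margP_dep P N x y (fun k hk => h k (Finset.mem_insert_of_mem hk))]
  have heven : ∀ ω, condP P i N (fun k => !ω k) = condP P i N ω := by
    intro ω
    unfold condP
    rw [margP_even P hev, margP_even P hev]
  have hsum : ∀ ω, condP P i N (Function.update ω i true)
      + condP P i N (Function.update ω i false) = 1 := by
    intro ω
    unfold condP
    have : ∀ b, margP P N (Function.update ω i b) = margP P N ω := by
      intro b
      apply margP_dep
      intro k hk
      rw [Function.update_of_ne]
      rintro rfl
      exact hi hk
    rw [this, this, ← add_div, ← margP_split P N i hi, div_self (margP_pos P hpos N ω).ne']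
  generalize condP P i N = f at *
  have hcase : N.card = 0 ∨ N.card = 1 ∨ N.card = 2 := by omega
  rcases hcase with h | h | h
  · obtain rfl := Finset.card_eq_zero.1 h
    refine ⟨fun _ => 0, fun ω => ?_⟩
    set F : Bool → ℝ := fun a => f (fun _ => a)
    have hf : ∀ ω, f ω = F (ω i) := fun ω => hdep _ _ (by simp)
    have e1 := heven (fun _ => true)
    have s1 := hsum (fun _ => true)
    rw [hf, hf] at e1 s1
    simp at e1 s1
    rw [hf]
    cases ω i <;> simp <;> linarith
  · obtain ⟨j, rfl⟩ := Finset.card_eq_one.1 h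
    have hij : j ≠ i := by rintro rfl; simp at hi
    set F : Bool → Bool → ℝ := fun a b => f (fun x => if x = i then a else b) with hF
    have hf : ∀ ω, f ω = F (ω i) (ω j) := fun ω => hdep _ _ (by simp [hij])
    have e : ∀ a b, F (!a) (!b) = F a b := by
      intro a b
      have := heven (fun x => if x = i then a else b)
      rw [hf, hf] at this
      simpa [hij] using this
    have s : ∀ b, F true b + F false b = 1 := by
      intro b
      have := hsum (fun x => b)
      rw [hf, hf] at this
      simpa [hij] using this
    clear_value F
    refine ⟨fun _ => 2 * F true true - 1, fun ω => ?_⟩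
    rw [hf]
    have e1 := e true true
    have e2 := e true false
    have s1 := s true
    have s2 := s false
    simp only [Bool.not_true, Bool.not_false] at e1 e2
    cases ω i <;> cases h2 : ω j <;> simp [sgn, h2] <;> linarith
  · obtain ⟨j, k, hjk, rfl⟩ := Finset.card_eq_two.1 h
    have hij : j ≠ i := by rintro rfl; simp at hi
    have hik : k ≠ i := by rintro rfl; simp at hi
    set F : Bool → Bool → Bool → ℝ :=
      fun a b c => f (fun x => if x = i then a else if x = j then b else c) with hF
    have hf : ∀ ω, f ω = F (ω i) (ω j) (ω k) :=
      fun ω => hdep _ _ (by simp [hij, hik, hjk.symm])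
    have e : ∀ a b c, F (!a) (!b) (!c) = F a b c := by
      intro a b c
      have := heven (fun x => if x = i then a else if x = j then b else c)
      rw [hf, hf] at this
      simpa [hij, hik, hjk.symm] using this
    have s : ∀ b c, F true b c + F false b c = 1 := by
      intro b c
      have := hsum (fun x => if x = j then b else c)
      rw [hf, hf] at this
      simpa [hij, hik, hjk.symm] using this
    clear_value F
    refine ⟨fun x => if x = j then F true true true + F true true false - 1
      else F true true true - F true true false, fun ω => ?_⟩
    rw [hf, Finset.sum_pair hjk]
    have e1 := e true true true
    have e2 := e true true false
    have e3 := e true false true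
    have e4 := e true false false
    have s1 := s true true
    have s2 := s true false
    have s3 := s false true
    have s4 := s false false
    simp only [Bool.not_true, Bool.not_false] at e1 e2 e3 e4
    simp only [if_true, if_neg hjk.symm]
    cases ω i <;> cases ω j <;> cases ω k <;> simp [sgn] <;> linarith

/-- **Generating palindromic Ising models over thin or bulged trees with linear
regressions (Corollary 1).**  If the edge-minimal concentration graph of a
palindromic Ising model is a thin tree or a bulged tree, then for any proper
single-node elimination scheme, each node has at most two neighbours among the
not-yet-eliminated nodes, the conditional probability of each response given those
neighbours is the main-effect linear regression
`P(A_i = ω_i | nb) = ½(1 + ∑_{j ∈ nb(i)} β_{i|j·} ω_i ω_j)` with constant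
coefficients, and the product of these factors recovers the joint distribution. -/
theorem stmt6 {d : ℕ} (P : (Fin d → Bool) → ℝ) (lam0 : ℝ) (lam : Fin d → Fin d → ℝ)
    (hP : IsPalindromicIsing P lam0 lam)
    (hTree : IsThinTree (concGraph lam) ∨ IsBulgedTree (concGraph lam))
    -- a proper (perfect) single-node elimination scheme:
    (ord : Equiv.Perm (Fin d))
    (hproper : ∀ k : Fin d, ∀ j1 ∈ laterNbrs lam ord k, ∀ j2 ∈ laterNbrs lam ord k,
      j1 ≠ j2 → (concGraph lam).Adj j1 j2) :
    (∀ k : Fin d, (laterNbrs lam ord k).card ≤ 2) ∧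
    ∃ β : Fin d → Fin d → ℝ,
      (∀ (k : Fin d) (ω : Fin d → Bool),
        condP P (ord k) (laterNbrs lam ord k) ω =
          (1 / 2) * (1 + ∑ j ∈ laterNbrs lam ord k,
            β (ord k) j * sgn (ω (ord k)) * sgn (ω j))) ∧
      (∀ ω : Fin d → Bool, P ω = ∏ k : Fin d, condP P (ord k) (laterNbrs lam ord k) ω) := by
  have hpos : ∀ ω, 0 < P ω := fun ω => by rw [hP.1]; exact Real.exp_pos _
  have hsgn : ∀ b : Bool, sgn (!b) = - sgn b := by intro b; cases b <;> simp [sgn]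
  have hev : ∀ ω, P (fun i => !ω i) = P ω := by
    intro ω
    rw [hP.1, hP.1]
    simp [isingExp, hsgn]
  have hcl : ∀ k, (concGraph lam).IsClique (laterNbrs lam ord k : Set (Fin d)) := by
    intro k a ha b hb hab
    exact hproper k a (by exact_mod_cast ha) b (by exact_mod_cast hb) hab
  have hnot : ∀ k, ord k ∉ laterSet ord k := by
    intro k; simp [laterSet]
  have hsub : ∀ k, laterNbrs lam ord k ⊆ laterSet ord k := fun k => Finset.filter_subset _ _
  have hnotN : ∀ k, ord k ∉ laterNbrs lam ord k := fun k h => hnot k (hsub k h)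
  have hcard : ∀ k, (laterNbrs lam ord k).card ≤ 2 := by
    intro k
    have := clique_card (concGraph lam) hTree (insert (ord k) (laterNbrs lam ord k))
      (Finset.insert_nonempty _ _) (by
        rw [Finset.coe_insert]
        refine (hcl k).insert fun b hb _ => ?_
        have hb' : b ∈ laterNbrs lam ord k := by exact_mod_cast hb
        exact (Finset.mem_filter.1 hb').2)
    rw [Finset.card_insert_of_notMem (hnotN k)] at this
    omega
  refine ⟨hcard, ?_⟩
  choose b hb using fun k => regress P hpos hev (ord k) (laterNbrs lam ord k) (hnotN k) (hcard k)
  refine ⟨fun i j => b (ord.symm i) j, fun k ω => by simpa using hb k ω, ?_⟩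
  intro ω
  set T : ℕ → Finset (Fin d) := fun n => Finset.univ.filter fun j => n ≤ (ord.symm j : ℕ) with hT
  have hT1 : ∀ k : Fin d, laterSet ord k = T (k + 1) := by
    intro k; ext j; simp [laterSet, hT, Nat.succ_le_iff]
  have hT2 : ∀ k : Fin d, insert (ord k) (laterSet ord k) = T k := by
    intro k; ext j
    simp only [laterSet, hT, Finset.mem_insert, Finset.mem_filter, Finset.mem_univ, true_and]
    rw [← Equiv.symm_apply_eq, Fin.lt_def, Fin.ext_iff]
    omega
  have hstep : ∀ k : Fin d, Fac (concGraph lam) (T k) (margP P (T k)) →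
      Fac (concGraph lam) (T (k + 1)) (margP P (T (k + 1))) ∧
      margP P (T k) ω = condP P (ord k) (laterNbrs lam ord k) ω * margP P (T (k + 1)) ω := by
    intro k hk
    rw [← hT1, ← hT2]
    rw [← hT2] at hk
    have := fac_step P hpos (concGraph lam) (ord k) (laterSet ord k) (laterNbrs lam ord k)
      (hnot k) (hsub k) (fun j hj h => Finset.mem_filter.2 ⟨hj, h⟩) (hcl k) hk
    exact ⟨this.1, this.2 ω⟩
  have hT0 : T 0 = Finset.univ := by ext; simp [hT]
  have hTd : T d = ∅ := by ext j; simp [hT]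
  have huniv : margP P Finset.univ = P := by
    funext e
    simp [margP, ← funext_iff]
  have main : ∀ n : ℕ, n ≤ d → Fac (concGraph lam) (T n) (margP P (T n)) ∧
      P ω = (∏ k ∈ Finset.univ.filter (fun k : Fin d => (k : ℕ) < n), condP P (ord k) (laterNbrs lam ord k) ω)
        * margP P (T n) ω := by
    intro n
    induction n with
    | zero =>
      intro _
      rw [hT0, huniv]
      exact ⟨fac_base P lam0 lam hP, by simp⟩
    | succ n ih =>
      intro hn
      obtain ⟨h1, h2⟩ := ih (by omega)
      obtain ⟨h3, h4⟩ := hstep ⟨n, hn⟩ h1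
      refine ⟨h3, ?_⟩
      have hset : (Finset.univ.filter fun k : Fin d => (k : ℕ) < n + 1) =
          insert ⟨n, hn⟩ (Finset.univ.filter fun k : Fin d => (k : ℕ) < n) := by
        ext k
        simp only [Finset.mem_insert, Finset.mem_filter, Finset.mem_univ, true_and, Fin.ext_iff]
        omega
      simp only at h4
      rw [hset, Finset.prod_insert (by simp), h2, h4]
      ring
  have := (main d le_rfl).2
  have h1 : margP P (T d) ω = 1 := by rw [hTd]; simpa [margP] using hP.2
  rw [h1, mul_one] at this
  simpa using this


end
end

section
/- In a trivariate palindromic Ising model with π_{ijk} = const·(1 + τ₁₂ ij)(1 + τ₁₃ ik)(1 + τ₂₃ jk), where 1/const = 2³(1 + τ₁₂τ₁₃τ₂₃), the margin of A₂, A₃ obtained by summing over i ∈ {−1,1} is π_{+jk} = ¼(1 + ρ₂₃ jk) with induced marginal correlation ρ₂₃ = τ_{23∖1} = (τ₂₃ + τ₁₂τ₁₃)/(1 + τ₁₂τ₁₃τ₂₃); in particular, if A₂ ⫫ A₃ | A₁ (τ₂₃ = 0), then ρ₂₃ = ρ₁₂ρ₁₃. -/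
open scoped BigOperators

noncomputable section

/-- **Marginalising a trivariate palindromic Ising model.**
With `π_{ijk} = const·(1 + τ₁₂ ij)(1 + τ₁₃ ik)(1 + τ₂₃ jk)` and
`1/const = 2³(1 + τ₁₂τ₁₃τ₂₃)`, the margin of `A₂, A₃` is
`π_{+jk} = ¼(1 + ρ₂₃ jk)` with `ρ₂₃ = (τ₂₃ + τ₁₂τ₁₃)/(1 + τ₁₂τ₁₃τ₂₃)`;
if moreover `τ₂₃ = 0` (i.e. `A₂ ⫫ A₃ | A₁`), then `ρ₂₃ = ρ₁₂ρ₁₃`. -/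
theorem stmt9 (t12 t13 t23 : ℝ)
    (h12 : |t12| < 1) (h13 : |t13| < 1) (h23 : |t23| < 1)
    (π : Bool → Bool → Bool → ℝ)
    (hπ : ∀ i j k, π i j k =
      (1 / (2 ^ 3 * (1 + t12 * t13 * t23))) *
        ((1 + t12 * sgn i * sgn j) * (1 + t13 * sgn i * sgn k) *
          (1 + t23 * sgn j * sgn k))) :
    (∀ j k, (∑ i : Bool, π i j k) =
      (1 / 4) * (1 + ((t23 + t12 * t13) / (1 + t12 * t13 * t23)) * sgn j * sgn k)) ∧
    ((∑ i : Bool, ∑ j : Bool, ∑ k : Bool, π i j k * sgn j * sgn k) =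
      (t23 + t12 * t13) / (1 + t12 * t13 * t23)) ∧
    (t23 = 0 →
      (∑ i : Bool, ∑ j : Bool, ∑ k : Bool, π i j k * sgn j * sgn k) =
        (∑ i : Bool, ∑ j : Bool, ∑ k : Bool, π i j k * sgn i * sgn j) *
          (∑ i : Bool, ∑ j : Bool, ∑ k : Bool, π i j k * sgn i * sgn k)) := by
  have hD : 1 + t12 * t13 * t23 ≠ 0 := by
    have h1 : |t12 * t13| < 1 := by
      rw [abs_mul]
      exact mul_lt_one_of_nonneg_of_lt_one_left (abs_nonneg _) h12 h13.le
    have h2 : |t12 * t13 * t23| < 1 := by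
      rw [abs_mul]
      exact mul_lt_one_of_nonneg_of_lt_one_left (abs_nonneg _) h1 h23.le
    have h3 := (abs_lt.mp h2).1
    intro h
    linarith
  refine ⟨?_, ?_, ?_⟩
  · intro j k
    simp only [hπ, Fintype.sum_bool]
    cases j <;> cases k <;> simp only [sgn, if_true, if_false, Bool.false_eq_true] <;>
      field_simp <;> ring
  · simp only [hπ, Fintype.sum_bool, sgn, if_true, if_false, Bool.false_eq_true]
    field_simp
    ring
  · intro h
    subst h
    simp only [hπ, Fintype.sum_bool, sgn, if_true, if_false, Bool.false_eq_true]
    simp only [mul_zero, add_zero, zero_mul]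
    ring

end
end

section
/- In a trivariate palindromic Ising model, the conditional probability of A₁ given A₂ = j and A₃ = k is π_{i|jk} = ½(1 + τ₁₂ ij)(1 + τ₁₃ ik)/(1 + τ₁₂τ₁₃ jk) = ½(1 + β_{1|2.3} ij + β_{1|3.2} ik), i.e. a main-effect linear regression with constant coefficients β_{1|2.3} = τ₁₂(1 − τ₁₃²)/(1 − τ₁₂²τ₁₃²) and β_{1|3.2} = τ₁₃(1 − τ₁₂²)/(1 − τ₁₂²τ₁₃²); in particular each linear regression coefficient is a positive multiple of the corresponding hypetan interaction. -/
open scoped BigOperators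

noncomputable section

/-- **Conditioning in a trivariate palindromic Ising model.**
The conditional probability of `A₁` given `A₂ = j, A₃ = k` is
`π_{i|jk} = ½(1 + τ₁₂ ij)(1 + τ₁₃ ik)/(1 + τ₁₂τ₁₃ jk)
          = ½(1 + β_{1|2.3} ij + β_{1|3.2} ik)`,
a main-effect linear regression with constant coefficients
`β_{1|2.3} = τ₁₂(1 − τ₁₃²)/(1 − τ₁₂²τ₁₃²)` and
`β_{1|3.2} = τ₁₃(1 − τ₁₂²)/(1 − τ₁₂²τ₁₃²)`; in particular each linear regression
coefficient is a positive multiple of the corresponding hypetan interaction. -/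
theorem stmt10 (t12 t13 t23 : ℝ)
    (h12 : |t12| < 1) (h13 : |t13| < 1) (h23 : |t23| < 1)
    (π : Bool → Bool → Bool → ℝ)
    (hπ : ∀ i j k, π i j k =
      (1 / (2 ^ 3 * (1 + t12 * t13 * t23))) *
        ((1 + t12 * sgn i * sgn j) * (1 + t13 * sgn i * sgn k) *
          (1 + t23 * sgn j * sgn k))) :
    (∀ i j k : Bool,
      π i j k / (∑ i' : Bool, π i' j k) =
        (1 / 2) * ((1 + t12 * sgn i * sgn j) * (1 + t13 * sgn i * sgn k)) /
          (1 + t12 * t13 * sgn j * sgn k) ∧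
      π i j k / (∑ i' : Bool, π i' j k) =
        (1 / 2) * (1 + (t12 * (1 - t13 ^ 2) / (1 - t12 ^ 2 * t13 ^ 2)) * sgn i * sgn j
          + (t13 * (1 - t12 ^ 2) / (1 - t12 ^ 2 * t13 ^ 2)) * sgn i * sgn k)) ∧
    (∃ c1 : ℝ, 0 < c1 ∧ t12 * (1 - t13 ^ 2) / (1 - t12 ^ 2 * t13 ^ 2) = c1 * t12) ∧
    (∃ c2 : ℝ, 0 < c2 ∧ t13 * (1 - t12 ^ 2) / (1 - t12 ^ 2 * t13 ^ 2) = c2 * t13) := by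
  obtain ⟨l12, u12⟩ := abs_lt.1 h12
  obtain ⟨l13, u13⟩ := abs_lt.1 h13
  obtain ⟨l23, u23⟩ := abs_lt.1 h23
  have hprod : |t12 * t13| < 1 := by
    rw [abs_mul]; exact mul_lt_one_of_nonneg_of_lt_one_left (abs_nonneg _) h12 h13.le
  obtain ⟨lp, up⟩ := abs_lt.1 hprod
  have htrip : |t12 * t13 * t23| < 1 := by
    rw [abs_mul]; exact mul_lt_one_of_nonneg_of_lt_one_left (abs_nonneg _) hprod h23.le
  obtain ⟨lt, ut⟩ := abs_lt.1 htrip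
  have hD : 0 < 1 - t12 ^ 2 * t13 ^ 2 := by nlinarith
  have hA : 0 < 1 - t12 ^ 2 := by nlinarith
  have hB : 0 < 1 - t13 ^ 2 := by nlinarith
  have hZ : 1 + t12 * t13 * t23 ≠ 0 := by linarith
  have hs : ∀ b, sgn b = 1 ∨ sgn b = -1 := by intro b; cases b <;> simp [sgn]
  refine ⟨fun i j k => ?_, ⟨(1 - t13 ^ 2) / (1 - t12 ^ 2 * t13 ^ 2), div_pos hB hD, by ring⟩,
    ⟨(1 - t12 ^ 2) / (1 - t12 ^ 2 * t13 ^ 2), div_pos hA hD, by ring⟩⟩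
  have hj2 : sgn j ^ 2 = 1 := by rcases hs j with h | h <;> simp [h]
  have hk2 : sgn k ^ 2 = 1 := by rcases hs k with h | h <;> simp [h]
  have hi2 : sgn i ^ 2 = 1 := by rcases hs i with h | h <;> simp [h]
  have hP : 1 + t12 * t13 * sgn j * sgn k ≠ 0 := by
    rcases hs j with h | h <;> rcases hs k with h' | h' <;> rw [h, h'] <;> linarith
  have hQ : 1 + t23 * sgn j * sgn k ≠ 0 := by
    rcases hs j with h | h <;> rcases hs k with h' | h' <;> rw [h, h'] <;> linarith
  have hsum : (∑ i' : Bool, π i' j k) = (1 / (2 ^ 3 * (1 + t12 * t13 * t23))) *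
      (2 * (1 + t12 * t13 * sgn j * sgn k) * (1 + t23 * sgn j * sgn k)) := by
    have e1 : sgn true = 1 := by simp [sgn]
    have e2 : sgn false = -1 := by simp [sgn]
    rw [Fintype.sum_bool, hπ, hπ, e1, e2]
    ring
  have h1 : π i j k / (∑ i' : Bool, π i' j k) =
        (1 / 2) * ((1 + t12 * sgn i * sgn j) * (1 + t13 * sgn i * sgn k)) /
          (1 + t12 * t13 * sgn j * sgn k) := by
    rw [hsum, hπ]
    generalize 1 + t12 * t13 * t23 = z at hZ ⊢
    generalize 1 + t12 * t13 * sgn j * sgn k = p at hP ⊢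
    generalize 1 + t23 * sgn j * sgn k = q at hQ ⊢
    field_simp
  refine ⟨h1, ?_⟩
  rw [h1, div_eq_iff hP]
  have hD' := hD.ne'
  field_simp
  rcases hs i with h | h <;> rcases hs j with h' | h' <;> rcases hs k with h'' | h'' <;>
    rw [h, h', h''] <;> ring

end
end

section
/- In a trivariate palindromic Ising model, the chance difference for success of A₁ on A₂ at a fixed level k of A₃, chd_{1|2.3} = P(A₁ = 1 | A₂ = 1, A₃ = k) − P(A₁ = 1 | A₂ = −1, A₃ = k), takes the same value at k = −1 and k = 1 and coincides with the linear least-squares regression coefficient β_{1|2.3} = (ρ₁₂ − ρ₁₃ρ₂₃)/(1 − ρ₂₃²) computed from the correlation matrix. -/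
open scoped BigOperators

noncomputable section

/-- `P(A₁ = 1 | A₂ = j, A₃ = k)` for a trivariate distribution. -/
def condProb1 (P : Bool → Bool → Bool → ℝ) (j k : Bool) : ℝ :=
  P true j k / (P true j k + P false j k)

/-- The chance difference for success of `A₁` on `A₂` at level `k` of `A₃`. -/
def chd (P : Bool → Bool → Bool → ℝ) (k : Bool) : ℝ :=
  condProb1 P true k - condProb1 P false k

/-- The correlation `ρ₁₂ = E[A₁A₂]` of a trivariate distribution. -/
def rho12 (P : Bool → Bool → Bool → ℝ) : ℝ :=
  ∑ i : Bool, ∑ j : Bool, ∑ k : Bool, P i j k * sgn i * sgn j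

/-- The correlation `ρ₁₃ = E[A₁A₃]`. -/
def rho13 (P : Bool → Bool → Bool → ℝ) : ℝ :=
  ∑ i : Bool, ∑ j : Bool, ∑ k : Bool, P i j k * sgn i * sgn k

/-- The correlation `ρ₂₃ = E[A₂A₃]`. -/
def rho23 (P : Bool → Bool → Bool → ℝ) : ℝ :=
  ∑ i : Bool, ∑ j : Bool, ∑ k : Bool, P i j k * sgn j * sgn k

/-- **Chance differences coincide with linear regression coefficients in trivariate
palindromic Ising models.**  The chance difference
`chd_{1|2.3} = P(A₁=1 | A₂=1, A₃=k) − P(A₁=1 | A₂=−1, A₃=k)` takes the same value at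
`k = −1` and `k = 1`, and coincides with the least-squares regression coefficient
`β_{1|2.3} = (ρ₁₂ − ρ₁₃ρ₂₃)/(1 − ρ₂₃²)` computed from the correlation matrix. -/
theorem stmt11 (l0 l12 l13 l23 : ℝ) (P : Bool → Bool → Bool → ℝ)
    (hP : ∀ i j k, P i j k =
      Real.exp (l0 + l12 * sgn i * sgn j + l13 * sgn i * sgn k + l23 * sgn j * sgn k))
    (hsum : (∑ i : Bool, ∑ j : Bool, ∑ k : Bool, P i j k) = 1) :
    chd P false = chd P true ∧
    chd P true = (rho12 P - rho13 P * rho23 P) / (1 - (rho23 P) ^ 2) := by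
  have hpos : ∀ i j k, 0 < P i j k := fun i j k => by rw [hP]; exact Real.exp_pos _
  have hpal : ∀ i j k, P (!i) (!j) (!k) = P i j k := by
    intro i j k
    rw [hP, hP]
    congr 1
    cases i <;> cases j <;> cases k <;> simp [sgn]
  have h1 : P false false false = P true true true := hpal true true true
  have h2 : P false false true = P true true false := hpal true true false
  have h3 : P false true false = P true false true := hpal true false true
  have h4 : P false true true = P true false false := hpal true false false
  have ha := hpos true true true
  have hb := hpos true true false
  have hc := hpos true false true
  have hd := hpos true false false
  simp only [chd, condProb1, rho12, rho13, rho23, Fintype.sum_bool, sgn, h1, h2, h3, h4] at hsum ⊢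
  simp only [if_true, Bool.false_eq_true, if_false]
  clear hP hpos hpal h1 h2 h3 h4
  generalize P true true true = a at *
  generalize P true true false = b at *
  generalize P true false true = c at *
  generalize P true false false = d at *
  have hbc : b + c ≠ 0 := by positivity
  have had : a + d ≠ 0 := by positivity
  have hcb : c + b ≠ 0 := by positivity
  have hda : d + a ≠ 0 := by positivity
  have hs : a = 1 / 2 - b - c - d := by linarith
  constructor
  · field_simp
    ring
  · have hden : ∀ r : ℝ, r = 2 * (a - b - c + d) →
        1 - r ^ 2 = 16 * (b + c) * (a + d) := by
      intro r hr
      rw [hr, hs]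
      ring
    rw [hden _ (by ring), div_sub_div _ _ had hcb, div_eq_div_iff (by positivity) (by positivity)]
    rw [hs]
    ring

end
end

section
/- In a trivariate palindromic Ising model, the conditional correlation ρ_{12|3}, i.e. the Pearson correlation of A₁ and A₂ in the conditional 2×2 table given A₃ = k, takes the same value at k = −1 and k = 1 and coincides with the partial correlation ρ_{12.3} = (ρ₁₂ − ρ₁₃ρ₂₃)/√((1 − ρ₁₃²)(1 − ρ₂₃²)) computed from the correlation matrix. -/
open scoped BigOperators

noncomputable section

/-- Conditional mean `E[A₁ | A₃ = k]`. -/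
def cmean1 (P : Bool → Bool → Bool → ℝ) (k : Bool) : ℝ :=
  (∑ i : Bool, ∑ j : Bool, P i j k * sgn i) / (∑ i : Bool, ∑ j : Bool, P i j k)

/-- Conditional mean `E[A₂ | A₃ = k]`. -/
def cmean2 (P : Bool → Bool → Bool → ℝ) (k : Bool) : ℝ :=
  (∑ i : Bool, ∑ j : Bool, P i j k * sgn j) / (∑ i : Bool, ∑ j : Bool, P i j k)

/-- Conditional mean `E[A₁A₂ | A₃ = k]`. -/
def cmean12 (P : Bool → Bool → Bool → ℝ) (k : Bool) : ℝ :=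
  (∑ i : Bool, ∑ j : Bool, P i j k * sgn i * sgn j) / (∑ i : Bool, ∑ j : Bool, P i j k)

/-- The conditional (Pearson) correlation `ρ_{12|3}` of `A₁, A₂` in the conditional
2×2 table given `A₃ = k`. -/
def ccorr12 (P : Bool → Bool → Bool → ℝ) (k : Bool) : ℝ :=
  (cmean12 P k - cmean1 P k * cmean2 P k) /
    Real.sqrt ((1 - (cmean1 P k) ^ 2) * (1 - (cmean2 P k) ^ 2))

/-- **Conditional correlations coincide with partial correlations in trivariate
palindromic Ising models.**  The conditional correlation `ρ_{12|3}` of `A₁` and `A₂`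
given `A₃ = k` takes the same value at `k = −1` and `k = 1` and coincides with the
partial correlation `ρ_{12.3} = (ρ₁₂ − ρ₁₃ρ₂₃)/√((1 − ρ₁₃²)(1 − ρ₂₃²))`. -/
theorem stmt12 (l0 l12 l13 l23 : ℝ) (P : Bool → Bool → Bool → ℝ)
    (hP : ∀ i j k, P i j k =
      Real.exp (l0 + l12 * sgn i * sgn j + l13 * sgn i * sgn k + l23 * sgn j * sgn k))
    (hsum : (∑ i : Bool, ∑ j : Bool, ∑ k : Bool, P i j k) = 1) :
    ccorr12 P false = ccorr12 P true ∧
    ccorr12 P true = (rho12 P - rho13 P * rho23 P) /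
      Real.sqrt ((1 - (rho13 P) ^ 2) * (1 - (rho23 P) ^ 2)) := by
  have sym : ∀ i j k, P (!i) (!j) (!k) = P i j k := by
    intro i j k
    rw [hP, hP]
    have h : ∀ b, sgn (!b) = - sgn b := by intro b; cases b <;> simp [sgn]
    rw [h, h, h]
    congr 1
    ring
  have h1 : P false false false = P true true true := sym true true true
  have h2 : P false false true = P true true false := sym true true false
  have h3 : P false true false = P true false true := sym true false true
  have h4 : P false true true = P true false false := sym true false false
  clear hP sym
  simp only [Fintype.sum_bool, h1, h2, h3, h4] at hsum
  have e : P true true true + P true false true + (P true false false + P true true false)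
      = 1 / 2 := by linarith
  have e' : P true true false + P true false false + (P true false true + P true true true)
      = 1 / 2 := by linarith
  have c1 : cmean1 P true = rho13 P := by
    simp only [cmean1, rho13, Fintype.sum_bool, h1, h2, h3, h4, e, sgn]
    simp
    ring
  have c2 : cmean2 P true = rho23 P := by
    simp only [cmean2, rho23, Fintype.sum_bool, h1, h2, h3, h4, e, sgn]
    simp
    ring
  have c3 : cmean12 P true = rho12 P := by
    simp only [cmean12, rho12, Fintype.sum_bool, h1, h2, h3, h4, e, sgn]
    simp
    ring
  have d1 : cmean1 P false = - rho13 P := by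
    simp only [cmean1, rho13, Fintype.sum_bool, h1, h2, h3, h4, e', sgn]
    simp
    ring
  have d2 : cmean2 P false = - rho23 P := by
    simp only [cmean2, rho23, Fintype.sum_bool, h1, h2, h3, h4, e', sgn]
    simp
    ring
  have d3 : cmean12 P false = rho12 P := by
    simp only [cmean12, rho12, Fintype.sum_bool, h1, h2, h3, h4, e', sgn]
    simp
    ring
  simp only [ccorr12, c1, c2, c3, d1, d2, d3, neg_mul_neg, neg_sq, and_self]

end
end

section
/- In a trivariate palindromic Ising model, the marginal hypetan interaction τ_{12∖3} (equal to the simple correlation ρ₁₂) coincides with τ₁₂ if and only if A₁ ⫫ A₃ | A₂ or A₂ ⫫ A₃ | A₁, i.e. if and only if τ₁₃ = 0 or τ₂₃ = 0; this follows from the recursion ρ₁₂ = τ_{12∖3} = (τ₁₂ + τ₁₃τ₂₃)/(1 + τ₁₂τ₁₃τ₂₃). -/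
open scoped BigOperators

noncomputable section

/-- **Collapsibility of the hypetan interaction in a trivariate palindromic Ising
model.**  The marginal hypetan interaction `τ_{12∖3}` (equal to the simple correlation
`ρ₁₂`) satisfies the recursion `ρ₁₂ = (τ₁₂ + τ₁₃τ₂₃)/(1 + τ₁₂τ₁₃τ₂₃)`, and it
coincides with `τ₁₂` if and only if `τ₁₃ = 0` (i.e. `A₁ ⫫ A₃ | A₂`) or `τ₂₃ = 0`
(i.e. `A₂ ⫫ A₃ | A₁`). -/
theorem stmt14 (t12 t13 t23 : ℝ)
    (h12 : |t12| < 1) (h13 : |t13| < 1) (h23 : |t23| < 1)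
    (π : Bool → Bool → Bool → ℝ)
    (hπ : ∀ i j k, π i j k =
      (1 / (2 ^ 3 * (1 + t12 * t13 * t23))) *
        ((1 + t12 * sgn i * sgn j) * (1 + t13 * sgn i * sgn k) *
          (1 + t23 * sgn j * sgn k))) :
    rho12 π = (t12 + t13 * t23) / (1 + t12 * t13 * t23) ∧
    (rho12 π = t12 ↔ (t13 = 0 ∨ t23 = 0)) := by
  have hab : |t12 * t13 * t23| < 1 := by
    rw [abs_mul, abs_mul]
    have h1 : |t12| * |t13| < 1 :=
      mul_lt_one_of_nonneg_of_lt_one_left (abs_nonneg _) h12 h13.le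
    exact mul_lt_one_of_nonneg_of_lt_one_left (by positivity) h1 h23.le
  have hD : 1 + t12 * t13 * t23 ≠ 0 := by
    have := (abs_lt.mp hab).1
    intro h
    linarith
  have key : rho12 π = (t12 + t13 * t23) / (1 + t12 * t13 * t23) := by
    simp only [rho12, hπ, Fintype.sum_bool, sgn, if_true, Bool.false_eq_true, if_false]
    field_simp
    ring
  refine ⟨key, ?_⟩
  have hs : 1 - t12 ^ 2 ≠ 0 := by
    have := (sq_lt_one_iff_abs_lt_one t12).mpr h12
    intro h
    linarith
  rw [key, div_eq_iff hD]
  constructor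
  · intro h
    have h0 : (t13 * t23) * (1 - t12 ^ 2) = 0 := by linear_combination h
    exact mul_eq_zero.mp ((mul_eq_zero.mp h0).resolve_right hs)
  · rintro (h | h) <;> rw [h] <;> ring

end
end

section
/- For a palindromic Ising model on four binary variables whose concentration graph is the chordless 4-cycle with missing edges for pairs (1,2) and (3,4) (so λ₁₂ = λ₃₄ = 0 and π_{ijkℓ} = const·(1 + τ₁₃ ik)(1 + τ₂₃ jk)(1 + τ₂₄ jℓ)(1 + τ₁₄ iℓ) with 1/const = 2⁴(1 + τ₁₃τ₁₄τ₂₃τ₂₄)), the induced marginal correlation of the uncoupled pair (1,2) is ρ*₁₂ = (τ₁₄τ₂₄ + τ₁₃τ₂₃)/(1 + τ₁₃τ₁₄τ₂₃τ₂₄), and the linear 4-factor interaction is ξ₁₂₃₄ = (τ₁₃τ₂₄ + τ₁₄τ₂₃)/(1 + τ₁₃τ₁₄τ₂₃τ₂₄). -/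
open scoped BigOperators

noncomputable section

/-- **Induced correlation and linear 4-factor interaction in the chordless 4-cycle.**
For a palindromic Ising model whose concentration graph is the chordless 4-cycle with
missing edges for the pairs (1,2) and (3,4), so that
`π_{ijkℓ} = const·(1 + τ₁₃ ik)(1 + τ₂₃ jk)(1 + τ₂₄ jℓ)(1 + τ₁₄ iℓ)` with
`1/const = 2⁴(1 + τ₁₃τ₁₄τ₂₃τ₂₄)`, the induced marginal correlation of the uncoupled
pair (1,2) is `ρ*₁₂ = E[A₁A₂] = (τ₁₄τ₂₄ + τ₁₃τ₂₃)/(1 + τ₁₃τ₁₄τ₂₃τ₂₄)` and the linear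
4-factor interaction is
`ξ₁₂₃₄ = E[A₁A₂A₃A₄] = (τ₁₃τ₂₄ + τ₁₄τ₂₃)/(1 + τ₁₃τ₁₄τ₂₃τ₂₄)`. -/
theorem stmt15 (t13 t14 t23 t24 : ℝ)
    (h13 : |t13| < 1) (h14 : |t14| < 1) (h23 : |t23| < 1) (h24 : |t24| < 1)
    (ht13 : t13 ≠ 0) (ht14 : t14 ≠ 0) (ht23 : t23 ≠ 0) (ht24 : t24 ≠ 0)
    (π : Bool → Bool → Bool → Bool → ℝ)
    (hπ : ∀ i j k l, π i j k l =
      (1 / (2 ^ 4 * (1 + t13 * t14 * t23 * t24))) *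
        ((1 + t13 * sgn i * sgn k) * (1 + t23 * sgn j * sgn k) *
          (1 + t24 * sgn j * sgn l) * (1 + t14 * sgn i * sgn l))) :
    (∑ i : Bool, ∑ j : Bool, ∑ k : Bool, ∑ l : Bool, π i j k l * sgn i * sgn j) =
      (t14 * t24 + t13 * t23) / (1 + t13 * t14 * t23 * t24) ∧
    (∑ i : Bool, ∑ j : Bool, ∑ k : Bool, ∑ l : Bool,
        π i j k l * sgn i * sgn j * sgn k * sgn l) =
      (t13 * t24 + t14 * t23) / (1 + t13 * t14 * t23 * t24) := by
  have hc : (1 : ℝ) / (2 ^ 4 * (1 + t13 * t14 * t23 * t24)) =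
      (1 + t13 * t14 * t23 * t24)⁻¹ / 16 := by
    rw [one_div, mul_inv]
    norm_num
    ring
  rw [hc] at hπ
  rw [div_eq_mul_inv, div_eq_mul_inv]
  generalize (1 + t13 * t14 * t23 * t24)⁻¹ = c at hπ ⊢
  constructor
  · simp only [Fintype.sum_bool, hπ, sgn, if_true, Bool.false_eq_true, if_false]
    ring
  · simp only [Fintype.sum_bool, hπ, sgn, if_true, Bool.false_eq_true, if_false]
    ring

end
end

section
/- For a palindromic Ising model on five binary variables whose concentration graph is the chordless 5-cycle with edges present exactly for pairs (1,3), (2,3), (1,4), (4,5), (2,5), the induced marginal correlation of the uncoupled pair (1,2) is ρ*₁₂ = τ_{12∖345} = (τ₁₄τ₄₅τ₂₅ + τ₁₃τ₂₃)/(1 + τ₁₄τ₄₅τ₂₅τ₁₃τ₂₃). -/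
open scoped BigOperators

noncomputable section

theorem exp_sgn (l : ℝ) (a b : Bool) :
    Real.exp (l * sgn a * sgn b) = Real.cosh l * (1 + Real.tanh l * sgn a * sgn b) := by
  have hc : Real.cosh l ≠ 0 := (Real.cosh_pos l).ne'
  have h1 : Real.cosh l * Real.tanh l = Real.sinh l := by
    rw [Real.tanh_eq_sinh_div_cosh]; field_simp
  have e1 := Real.cosh_add_sinh l
  have e2 := Real.cosh_sub_sinh l
  cases a <;> cases b <;> simp [sgn] <;> linarith

/-- **Induced correlation of an uncoupled pair in the chordless 5-cycle.**
For a palindromic Ising model on five binary variables whose concentration graph is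
the chordless 5-cycle with edges present exactly for the pairs
(1,3), (2,3), (1,4), (4,5), (2,5), the induced marginal correlation of the uncoupled
pair (1,2) is
`ρ*₁₂ = τ_{12∖345} = (τ₁₄τ₄₅τ₂₅ + τ₁₃τ₂₃)/(1 + τ₁₄τ₄₅τ₂₅τ₁₃τ₂₃)`,
where `τ_e = tanh(λ_e)`. -/
theorem stmt16 (l0 l13 l23 l14 l45 l25 : ℝ)
    (h13 : l13 ≠ 0) (h23 : l23 ≠ 0) (h14 : l14 ≠ 0) (h45 : l45 ≠ 0) (h25 : l25 ≠ 0)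
    (P : Bool → Bool → Bool → Bool → Bool → ℝ)
    (hP : ∀ a1 a2 a3 a4 a5, P a1 a2 a3 a4 a5 =
      Real.exp (l0 + l13 * sgn a1 * sgn a3 + l23 * sgn a2 * sgn a3 +
        l14 * sgn a1 * sgn a4 + l45 * sgn a4 * sgn a5 + l25 * sgn a2 * sgn a5))
    (hsum : (∑ a1 : Bool, ∑ a2 : Bool, ∑ a3 : Bool, ∑ a4 : Bool, ∑ a5 : Bool,
      P a1 a2 a3 a4 a5) = 1) :
    (∑ a1 : Bool, ∑ a2 : Bool, ∑ a3 : Bool, ∑ a4 : Bool, ∑ a5 : Bool,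
        P a1 a2 a3 a4 a5 * sgn a1 * sgn a2) =
      (Real.tanh l14 * Real.tanh l45 * Real.tanh l25 +
        Real.tanh l13 * Real.tanh l23) /
      (1 + Real.tanh l14 * Real.tanh l45 * Real.tanh l25 *
        Real.tanh l13 * Real.tanh l23) := by
  have hP' : ∀ a1 a2 a3 a4 a5, P a1 a2 a3 a4 a5 =
      (Real.exp l0 * Real.cosh l13 * Real.cosh l23 * Real.cosh l14 * Real.cosh l45 *
        Real.cosh l25) *
      ((1 + Real.tanh l13 * sgn a1 * sgn a3) * (1 + Real.tanh l23 * sgn a2 * sgn a3) *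
        (1 + Real.tanh l14 * sgn a1 * sgn a4) * (1 + Real.tanh l45 * sgn a4 * sgn a5) *
        (1 + Real.tanh l25 * sgn a2 * sgn a5)) := by
    intro a1 a2 a3 a4 a5
    rw [hP]
    simp only [Real.exp_add, exp_sgn]
    ring
  clear hP
  generalize Real.exp l0 * Real.cosh l13 * Real.cosh l23 * Real.cosh l14 * Real.cosh l45 *
        Real.cosh l25 = K at hP'
  simp only [hP', Fintype.sum_bool, sgn] at hsum ⊢
  simp only [if_true, Bool.false_eq_true, if_false] at hsum ⊢
  generalize Real.tanh l13 = t13 at *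
  generalize Real.tanh l23 = t23 at *
  generalize Real.tanh l14 = t14 at *
  generalize Real.tanh l45 = t45 at *
  generalize Real.tanh l25 = t25 at *
  have hZ : 32 * K * (1 + t14 * t45 * t25 * t13 * t23) = 1 := by
    refine Eq.trans ?_ hsum
    ring
  have hD : 1 + t14 * t45 * t25 * t13 * t23 ≠ 0 := by
    intro h
    rw [h] at hZ
    simp at hZ
  rw [eq_div_iff hD]
  trans (32 * K * (1 + t14 * t45 * t25 * t13 * t23)) * (t14 * t45 * t25 + t13 * t23)
  · ring
  · rw [hZ, one_mul]

end
end

section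
/- For a palindromic Ising model on four binary variables whose concentration graph is the chordless 4-cycle with missing edges for pairs (1,2) and (3,4) (so π_{ijkℓ} = const·(1 + τ₁₃ ik)(1 + τ₂₃ jk)(1 + τ₂₄ jℓ)(1 + τ₁₄ iℓ), 1/const = 2⁴(1 + τ₁₃τ₁₄τ₂₃τ₂₄)), marginalising over the first variable gives π_{+jkℓ} = const′·(1 + τ₂₃ jk)(1 + τ₂₄ jℓ)(1 + τ₁₃τ₁₄ kℓ) with 1/const′ = 2³(1 + τ₁₃τ₁₄τ₂₃τ₂₄); thus the margin is again of palindromic Ising product form with induced interaction τ_{34∖1} = τ₁₃τ₁₄, and the marginal correlation of an edge present in the cycle is ρ₂₃ = (τ₂₃ + τ₂₄τ₁₄τ₁₃)/(1 + τ₁₃τ₁₄τ₂₃τ₂₄). -/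
open scoped BigOperators

noncomputable section

/-- **Marginalising one variable out of the chordless 4-cycle.**
For a palindromic Ising model whose concentration graph is the chordless 4-cycle with
missing edges for the pairs (1,2) and (3,4), so that
`π_{ijkℓ} = const·(1 + τ₁₃ ik)(1 + τ₂₃ jk)(1 + τ₂₄ jℓ)(1 + τ₁₄ iℓ)` with
`1/const = 2⁴(1 + τ₁₃τ₁₄τ₂₃τ₂₄)`, marginalising over the first variable gives
`π_{+jkℓ} = const′·(1 + τ₂₃ jk)(1 + τ₂₄ jℓ)(1 + τ₁₃τ₁₄ kℓ)` with
`1/const′ = 2³(1 + τ₁₃τ₁₄τ₂₃τ₂₄)`, so the margin is again of palindromic Ising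
product form with induced interaction `τ_{34∖1} = τ₁₃τ₁₄`; and the marginal
correlation of the edge (2,3) present in the cycle is
`ρ₂₃ = (τ₂₃ + τ₂₄τ₁₄τ₁₃)/(1 + τ₁₃τ₁₄τ₂₃τ₂₄)`. -/
theorem stmt17 (t13 t14 t23 t24 : ℝ)
    (h13 : |t13| < 1) (h14 : |t14| < 1) (h23 : |t23| < 1) (h24 : |t24| < 1)
    (π : Bool → Bool → Bool → Bool → ℝ)
    (hπ : ∀ i j k l, π i j k l =
      (1 / (2 ^ 4 * (1 + t13 * t14 * t23 * t24))) *
        ((1 + t13 * sgn i * sgn k) * (1 + t23 * sgn j * sgn k) *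
          (1 + t24 * sgn j * sgn l) * (1 + t14 * sgn i * sgn l))) :
    (∀ j k l : Bool, (∑ i : Bool, π i j k l) =
      (1 / (2 ^ 3 * (1 + t13 * t14 * t23 * t24))) *
        ((1 + t23 * sgn j * sgn k) * (1 + t24 * sgn j * sgn l) *
          (1 + t13 * t14 * sgn k * sgn l))) ∧
    (∑ i : Bool, ∑ j : Bool, ∑ k : Bool, ∑ l : Bool, π i j k l * sgn j * sgn k) =
      (t23 + t24 * t14 * t13) / (1 + t13 * t14 * t23 * t24) := by
  have e1 : 1 / (2 ^ 4 * (1 + t13 * t14 * t23 * t24))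
      = (1 + t13 * t14 * t23 * t24)⁻¹ / 16 := by
    rw [one_div, mul_inv]; ring
  have e2 : 1 / (2 ^ 3 * (1 + t13 * t14 * t23 * t24))
      = (1 + t13 * t14 * t23 * t24)⁻¹ / 8 := by
    rw [one_div, mul_inv]; ring
  rw [e1] at hπ
  rw [e2, div_eq_mul_inv (t23 + t24 * t14 * t13)]
  generalize (1 + t13 * t14 * t23 * t24)⁻¹ = c at *
  constructor
  · intro j k l
    simp only [Fintype.sum_bool, hπ]
    cases j <;> cases k <;> cases l <;> simp [sgn] <;> ring
  · simp only [Fintype.sum_bool, hπ]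
    simp [sgn]
    ring


end
end
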